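/- arXiv:2012.02335 — 2 statements merged into one kernel-verified Lean document; each statement's English description precedes it below -/
import Mathlib

section
/- There exists a universal constant c > 0 such that for every positive integer n and every Boolean function f : {-1,1}^n → {-1,1} with Fourier sparsity k(f) > 1, the weight satisfies δ(f) ≥ c · r(f)^2 / (k(f) · (log k(f))^2); equivalently, r(f) = O(√(k(f)·δ(f)) · log k(f)). -/
open scoped BigOperators
open scoped Classical

noncomputable section

namespace BoolFunc

/-- Real value of a hypercube coordinate: `true ↦ -1`, `false ↦ 1`. -/
def signv (b : Bool) : ℝ := if b then -1 else 1

/-- Fourier coefficient `f̂(S)` of `f : {-1,1}ⁿ → ℝ`. -/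
def fourierCoeff {n : ℕ} (f : (Fin n → Bool) → ℝ) (S : Finset (Fin n)) : ℝ :=
  (∑ x : Fin n → Bool, f x * ∏ i ∈ S, signv (x i)) / 2 ^ n

/-- Fourier support of `f`. -/
def fourierSupport {n : ℕ} (f : (Fin n → Bool) → ℝ) : Finset (Finset (Fin n)) :=
  Finset.univ.filter (fun S => fourierCoeff f S ≠ 0)

/-- Fourier sparsity `k(f)`. -/
def sparsity {n : ℕ} (f : (Fin n → Bool) → ℝ) : ℕ := (fourierSupport f).card

/-- Indicator vector in `F₂ⁿ` of a subset of `[n]`. -/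
def indicatorVec {n : ℕ} (S : Finset (Fin n)) : Fin n → ZMod 2 :=
  fun i => if i ∈ S then 1 else 0

/-- Fourier rank `r(f)`: the `F₂`-dimension of the span of the Fourier support. -/
def fourierRank {n : ℕ} (f : (Fin n → Bool) → ℝ) : ℕ :=
  Module.finrank (ZMod 2)
    ↥(Submodule.span (ZMod 2)
      (indicatorVec '' (fourierSupport f : Set (Finset (Fin n)))))

/-- Weight `δ(f) = Pr[f(x) = -1]`. -/
def weight {n : ℕ} (f : (Fin n → Bool) → ℝ) : ℝ :=
  ((Finset.univ.filter (fun x : Fin n → Bool => f x = -1)).card : ℝ) / 2 ^ n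

/-- Fourier max-supp-entropy `k'(f) = max_{S ∈ supp(f)} 1/|f̂(S)|`. -/
def maxSuppEntropy {n : ℕ} (f : (Fin n → Bool) → ℝ) : ℝ :=
  sSup ((fun S => 1 / |fourierCoeff f S|) '' (fourierSupport f : Set (Finset (Fin n))))

/-- Dimension of the span of `{S : |f̂(S)| ≥ 1/t}`. -/
def levelDim {n : ℕ} (f : (Fin n → Bool) → ℝ) (t : ℝ) : ℕ :=
  Module.finrank (ZMod 2)
    ↥(Submodule.span (ZMod 2)
      (indicatorVec '' {S : Finset (Fin n) | 1 / t ≤ |fourierCoeff f S|}))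

/-- Fourier max-rank-entropy `k''(f)`. -/
def maxRankEntropy {n : ℕ} (f : (Fin n → Bool) → ℝ) : ℝ :=
  sInf {t : ℝ | 0 < t ∧ levelDim f t = fourierRank f}

/-- `f` is Boolean-valued (takes values in `{-1,1}`). -/
def IsBooleanFunc {n : ℕ} (f : (Fin n → Bool) → ℝ) : Prop := ∀ x, f x = 1 ∨ f x = -1

/-- The real sign character of `ZMod 2`. -/
def sgn : AddChar (ZMod 2) ℝ where
  toFun z := if z = 0 then 1 else -1
  map_zero_eq_one' := by simp
  map_add_eq_mul' := by
    have h1 : (1 : ZMod 2) + 1 = 0 := by decide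
    have hz : ∀ z : ZMod 2, z = 0 ∨ z = 1 := by decide
    intro a b
    rcases hz a with rfl | rfl <;> rcases hz b with rfl | rfl <;> simp [h1]

lemma sgn_one : sgn 1 = -1 := by simp [sgn]

/-- The support of a spectrum. -/
def supp {G : Type*} [Fintype G] (a : G → ℝ) : Finset G := Finset.univ.filter fun S => a S ≠ 0

lemma mem_supp {G : Type*} [Fintype G] {a : G → ℝ} {S : G} : S ∈ supp a ↔ a S ≠ 0 := by simp [supp]

section SpectrumBasic

variable {G : Type*} [AddCommGroup G] [Fintype G]

/-- The spectrum of a `±1`-valued function: its self-convolution is the unit mass at `0`. -/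
def IsBoolSpectrum (a : G → ℝ) : Prop :=
  ∀ γ, ∑ S, a S * a (S + γ) = if γ = 0 then 1 else 0

lemma IsBoolSpectrum.sum_sq {a : G → ℝ} (ha : IsBoolSpectrum a) : ∑ S, a S ^ 2 = 1 := by
  simpa [sq] using ha 0

lemma IsBoolSpectrum.abs_le_one {a : G → ℝ} (ha : IsBoolSpectrum a) (S : G) : |a S| ≤ 1 := by
  rw [← sq_le_one_iff_abs_le_one, ← ha.sum_sq]
  exact Finset.single_le_sum (f := fun S => a S ^ 2) (fun i _ => sq_nonneg _) (Finset.mem_univ S)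

lemma IsBoolSpectrum.one_le_sum_abs {a : G → ℝ} (ha : IsBoolSpectrum a) : 1 ≤ ∑ S, |a S| := by
  rw [← ha.sum_sq]
  refine Finset.sum_le_sum fun S _ => ?_
  rw [← sq_abs]
  nlinarith [ha.abs_le_one S, abs_nonneg (a S)]

end SpectrumBasic

section Spectrum

variable {G : Type*} [AddCommGroup G] [Module (ZMod 2) G]

lemma addChar_mul_self (ψ : AddChar G ℝ) (S : G) : ψ S * ψ S = 1 := by
  rw [← AddChar.map_add_eq_mul, ZModModule.add_self, AddChar.map_zero_eq_one]

lemma add_add_self (S T : G) : S + T + T = S := by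
  rw [add_assoc, ZModModule.add_self, add_zero]

/-- The projection with kernel spanned by `γ`, when `l γ = 1`. -/
def foldMap (l : Module.Dual (ZMod 2) G) (γ : G) : G →ₗ[ZMod 2] G :=
  LinearMap.id - l.smulRight γ

lemma foldMap_apply (l : Module.Dual (ZMod 2) G) (γ S : G) :
    foldMap l γ S = if l S = 0 then S else S + γ := by
  have h : ∀ z : ZMod 2, z = 0 ∨ z = 1 := by decide
  rcases h (l S) with h | h
  · simp [foldMap, h]
  · simp [foldMap, h, ZModModule.sub_eq_add]

variable [Fintype G]

/-- Pushforward along `φ` of the spectrum `a` twisted by the character `ψ`. -/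
def push (φ : G →ₗ[ZMod 2] G) (ψ : AddChar G ℝ) (a : G → ℝ) (T : G) : ℝ :=
  ∑ S with φ S = T, ψ S * a S

lemma isBoolSpectrum_push {a : G → ℝ} (ha : IsBoolSpectrum a) (φ : G →ₗ[ZMod 2] G)
    (ψ : AddChar G ℝ) : IsBoolSpectrum (push φ ψ a) := by
  intro γ
  have h1 : ∀ S, push φ ψ a (φ S + γ)
      = ∑ η with φ η = γ, ψ (S + η) * a (S + η) := by
    intro S
    unfold push
    rw [Finset.sum_filter, Finset.sum_filter]
    refine (Fintype.sum_equiv (Equiv.addLeft S) _ _ ?_).symm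
    intro η
    simp
  have h2 : ∑ T, push φ ψ a T * push φ ψ a (T + γ)
      = ∑ S, ψ S * a S * push φ ψ a (φ S + γ) := by
    rw [← Finset.sum_fiberwise Finset.univ φ
      fun S => ψ S * a S * push φ ψ a (φ S + γ)]
    refine Finset.sum_congr rfl fun T _ => ?_
    rw [show push φ ψ a T = ∑ S with φ S = T, ψ S * a S from rfl, Finset.sum_mul]
    refine Finset.sum_congr rfl fun S hS => ?_
    rw [(Finset.mem_filter.mp hS).2]
  rw [h2]
  simp_rw [h1, Finset.mul_sum]
  rw [Finset.sum_comm]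
  have h3 : ∀ η, ∑ S, ψ S * a S * (ψ (S + η) * a (S + η)) = if η = 0 then 1 else 0 := by
    intro η
    have : ∀ S, ψ S * a S * (ψ (S + η) * a (S + η)) = ψ η * (a S * a (S + η)) := by
      intro S
      rw [AddChar.map_add_eq_mul]
      linear_combination (ψ η * a S * a (S + η)) * addChar_mul_self ψ S
    simp_rw [this]
    rw [← Finset.mul_sum, ha η]
    by_cases h : η = 0 <;> simp [h]
  simp_rw [h3]
  rw [Finset.sum_filter, Finset.sum_eq_single 0]
  · simp [eq_comm]
  · intro b _ hb
    simp [hb]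
  · simp

lemma push_push (φ φ' : G →ₗ[ZMod 2] G) (ψ ψ' : AddChar G ℝ) (a : G → ℝ) :
    push φ' ψ' (push φ ψ a)
      = push (φ' ∘ₗ φ) (ψ * ψ'.compAddMonoidHom φ.toAddMonoidHom) a := by
  funext T
  unfold push
  simp only [Finset.sum_filter, Finset.mul_sum, mul_ite, mul_zero]
  have : ∀ U, (if φ' U = T then ∑ S, if φ S = U then ψ' U * (ψ S * a S) else 0 else 0)
      = ∑ S, if φ S = U then (if φ' (φ S) = T then ψ' (φ S) * (ψ S * a S) else 0) else 0 := by
    intro U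
    split_ifs with h
    · refine Finset.sum_congr rfl fun S _ => ?_
      split_ifs with h1 hs
      · rw [h1]
      · exact absurd (h1 ▸ h) hs
      · rfl
    · symm
      refine Finset.sum_eq_zero fun S _ => ?_
      split_ifs with h1 h2
      · exact absurd (h1 ▸ h2) h
      · rfl
      · rfl
  simp_rw [this]
  rw [Finset.sum_comm]
  refine Finset.sum_congr rfl fun S _ => ?_
  rw [Finset.sum_ite_eq]
  simp only [Finset.mem_univ, if_true, LinearMap.comp_apply, AddChar.mul_apply,
    AddChar.compAddMonoidHom_apply, LinearMap.toAddMonoidHom_coe]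
  split_ifs
  · ring
  · rfl

lemma finrank_ker_comp_le (φ φ' : G →ₗ[ZMod 2] G) :
    Module.finrank (ZMod 2) (LinearMap.ker (φ' ∘ₗ φ))
      ≤ Module.finrank (ZMod 2) (LinearMap.ker φ) + Module.finrank (ZMod 2) (LinearMap.ker φ') := by
  have hfin : Module.Finite (ZMod 2) G := Module.Finite.of_finite
  set K := LinearMap.ker (φ' ∘ₗ φ) with hK
  have h := (φ.domRestrict K).finrank_range_add_finrank_ker
  have h1 : Module.finrank (ZMod 2) (LinearMap.range (φ.domRestrict K))
      ≤ Module.finrank (ZMod 2) (LinearMap.ker φ') := by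
    apply Submodule.finrank_mono
    rintro _ ⟨⟨x, hx⟩, rfl⟩
    simpa [hK] using hx
  have h2 : Module.finrank (ZMod 2) (LinearMap.ker (φ.domRestrict K))
      ≤ Module.finrank (ZMod 2) (LinearMap.ker φ) := by
    rw [← Submodule.finrank_map_subtype_eq K (LinearMap.ker (φ.domRestrict K))]
    apply Submodule.finrank_mono
    rintro _ ⟨⟨x, hx⟩, hx', rfl⟩
    simpa using hx'
  omega

lemma finrank_ker_foldMap_le (l : Module.Dual (ZMod 2) G) (γ : G) :
    Module.finrank (ZMod 2) (LinearMap.ker (foldMap l γ)) ≤ 1 := by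
  have hfin : Module.Finite (ZMod 2) G := Module.Finite.of_finite
  refine le_trans (Submodule.finrank_mono (t := Submodule.span (ZMod 2) {γ}) ?_)
    (le_trans (finrank_span_le_card _) (by simp))
  intro x hx
  have : x = l x • γ := by
    simpa [foldMap, sub_eq_zero] using hx
  rw [this]
  exact Submodule.smul_mem _ _ (Submodule.mem_span_singleton_self γ)

/-- Folding along `γ ≠ 0` with sign `b`. -/
lemma exists_fold {γ : G} (hγ : γ ≠ 0) {b : ℝ} (hb : b = 1 ∨ b = -1) :
    ∃ (l : Module.Dual (ZMod 2) G) (ψ : AddChar G ℝ), l γ = 1 ∧ ∀ (a : G → ℝ) (T : G),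
      push (foldMap l γ) ψ a T = if l T = 0 then a T + b * a (T + γ) else 0 := by
  have hz : ∀ z : ZMod 2, z ≠ 0 → z = 1 := by decide
  have h11 : (1 : ZMod 2) + 1 = 0 := by decide
  obtain ⟨l, hl⟩ : ∃ l : Module.Dual (ZMod 2) G, l γ ≠ 0 := by
    by_contra! h
    exact hγ ((Module.forall_dual_apply_eq_zero_iff (ZMod 2) γ).mp h)
  replace hl := hz _ hl
  obtain ⟨ψ, hψ0, hψ1⟩ : ∃ ψ : AddChar G ℝ, (∀ S, l S = 0 → ψ S = 1) ∧ ψ γ = b := by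
    rcases hb with rfl | rfl
    · exact ⟨1, by simp, by simp⟩
    · refine ⟨sgn.compAddMonoidHom l.toAddMonoidHom, ?_, ?_⟩
      · intro S hS
        simp [hS]
      · simp [hl, sgn_one]
  refine ⟨l, ψ, hl, fun a T => ?_⟩
  unfold push
  split_ifs with hT
  · have : (Finset.univ.filter fun S => foldMap l γ S = T) = {T, T + γ} := by
      ext S
      simp only [Finset.mem_filter, Finset.mem_univ, true_and, Finset.mem_insert,
        Finset.mem_singleton, foldMap_apply]
      constructor
      · split_ifs with h
        · exact Or.inl
        · rintro rfl
          exact Or.inr (add_add_self _ _).symm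
      · rintro (rfl | rfl)
        · simp [hT]
        · simp [hT, hl, add_add_self]
    rw [this, Finset.sum_pair (by simpa using hγ)]
    rw [AddChar.map_add_eq_mul, hψ0 T hT, hψ1]
    ring
  · refine Finset.sum_eq_zero fun S hS => ?_
    exfalso
    apply hT
    rw [← (Finset.mem_filter.mp hS).2, foldMap_apply]
    split_ifs with h
    · exact h
    · rw [map_add, hl, hz _ h, h11]

/-- Summing the absolute values of a folded spectrum. -/
lemma sum_abs_fold (a : G → ℝ) {γ : G} {b : ℝ} (hb : b = 1 ∨ b = -1)
    {l : Module.Dual (ZMod 2) G} (hl : l γ = 1) :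
    2 * ∑ T, |if l T = 0 then a T + b * a (T + γ) else 0| = ∑ T, |a T + b * a (T + γ)| := by
  have hz : ∀ z : ZMod 2, z + 1 = 0 ↔ ¬ z = 0 := by decide
  have hsymm : ∀ T, |a (T + γ) + b * a (T + γ + γ)| = |a T + b * a (T + γ)| := by
    intro T
    rw [add_add_self]
    rcases hb with rfl | rfl
    · congr 1
      ring
    · rw [← abs_neg]
      congr 1
      ring
  have h1 : ∀ T, |if l T = 0 then a T + b * a (T + γ) else 0|
      = if l T = 0 then |a T + b * a (T + γ)| else 0 := by
    intro T
    split_ifs <;> simp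
  simp_rw [h1]
  have h2 : ∑ T, (if l T = 0 then |a T + b * a (T + γ)| else 0)
      = ∑ T, if l T = 0 then 0 else |a T + b * a (T + γ)| := by
    refine Fintype.sum_equiv (Equiv.addRight γ) _ _ fun T => ?_
    simp only [Equiv.coe_addRight, map_add, hl, hz, hsymm]
    split_ifs <;> rfl
  rw [two_mul]
  nth_rewrite 2 [h2]
  rw [← Finset.sum_add_distrib]
  refine Finset.sum_congr rfl fun T _ => ?_
  split_ifs <;> simp

lemma abs_add_le_of_abs_le {u v m : ℝ} (hm : 0 < m) (hu : |u| ≤ m) (hv : |v| ≤ m) :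
    |u + v| ≤ |u| + |v| + 2 * (u * v) / m := by
  rw [abs_le] at hu hv
  have key : 0 ≤ (|u| + |v| - |u + v|) * m + 2 * (u * v) := by
    rcases abs_cases u with ⟨h1, _⟩ | ⟨h1, _⟩ <;> rcases abs_cases v with ⟨h2, _⟩ | ⟨h2, _⟩ <;>
      rcases abs_cases (u + v) with ⟨h3, _⟩ | ⟨h3, _⟩ <;> rw [h1, h2, h3] <;> nlinarith
  have : 0 ≤ ((|u| + |v| - |u + v|) * m + 2 * (u * v)) / m := div_nonneg key hm.le
  have h2 : ((|u| + |v| - |u + v|) * m + 2 * (u * v)) / m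
      = |u| + |v| - |u + v| + 2 * (u * v) / m := by
    field_simp
  linarith

/-- Folding so that the two largest coefficients are added decreases the spectral norm by twice
the largest coefficient. -/
lemma IsBoolSpectrum.sum_abs_fold_le {a : G → ℝ} (ha : IsBoolSpectrum a) {α β : G} (hαβ : α ≠ β)
    (hα : ∀ S, |a S| ≤ |a α|) (hβ : ∀ S, S ≠ α → |a S| ≤ |a β|) (hβ0 : a β ≠ 0)
    {b : ℝ} (hb : b = 1 ∨ b = -1) (hab : b * (a α * a β) = |a α| * |a β|) :
    ∑ T, |a T + b * a (T + (α + β))| ≤ 2 * ∑ T, |a T| - 4 * |a α| := by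
  have hm : 0 < |a β| := abs_pos.mpr hβ0
  have hbabs : |b| = 1 := by rcases hb with rfl | rfl <;> simp
  have hγ : α + β ≠ 0 := by
    intro h
    apply hαβ
    rw [← add_add_self α β, h, zero_add]
  have hαγ : α + (α + β) = β := by
    rw [add_comm α β, ← add_assoc, add_comm α β, add_add_self]
  have hβγ : β + (α + β) = α := by
    rw [← add_assoc, add_comm β α, add_add_self]
  have habs : ∀ u v : ℝ, b * (u * v) = |u| * |v| → |u + b * v| ≤ |u| + |v| := by
    intro u v _
    refine (abs_add_le _ _).trans ?_
    rw [abs_mul, hbabs, one_mul]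
  have hpt : ∀ T, |a T + b * a (T + (α + β))| ≤ |a T| + |a (T + (α + β))|
      + 2 * b / |a β| * (a T * a (T + (α + β)))
      - ((if T = α then 2 * |a α| else 0) + if T = β then 2 * |a α| else 0) := by
    intro T
    by_cases h1 : T = α
    · subst h1
      rw [hαγ, if_pos rfl, if_neg hαβ]
      have := habs _ _ hab
      have h2 : 2 * b / |a β| * (a T * a β) = 2 * |a T| := by
        rw [div_mul_eq_mul_div, mul_assoc, hab]
        field_simp
      rw [h2]
      linarith
    by_cases h2 : T = β
    · subst h2
      rw [hβγ, if_pos rfl, if_neg h1]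
      have := habs (a T) (a α) (by rw [mul_comm (a T), hab, mul_comm])
      have h2 : 2 * b / |a T| * (a T * a α) = 2 * |a α| := by
        rw [div_mul_eq_mul_div, mul_assoc, mul_comm (a T), hab]
        field_simp
      rw [h2]
      linarith
    · have h3 : T + (α + β) ≠ α := by
        intro h
        apply h2
        rw [← add_add_self T (α + β), h, hαγ]
      have := abs_add_le_of_abs_le hm (u := a T) (v := b * a (T + (α + β))) (hβ T h1)
        (by rw [abs_mul, hbabs, one_mul]; exact hβ _ h3)
      rw [if_neg h1, if_neg h2]
      rw [abs_mul b, hbabs, one_mul] at this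
      refine this.trans (le_of_eq ?_)
      ring
  refine (Finset.sum_le_sum fun T _ => hpt T).trans (le_of_eq ?_)
  rw [Finset.sum_sub_distrib, Finset.sum_add_distrib, Finset.sum_add_distrib,
    Finset.sum_add_distrib, ← Finset.mul_sum, ha, if_neg hγ, Finset.sum_ite_eq', Finset.sum_ite_eq']
  have : ∑ T, |a (T + (α + β))| = ∑ T, |a T| :=
    Fintype.sum_equiv (Equiv.addRight (α + β)) _ _ fun T => rfl
  rw [this]
  simp only [Finset.mem_univ, if_true]
  ring

/-- A `±1`-valued function of spectral norm at most `A` becomes constant on an affine subspace of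
small codimension: auxiliary form, inducting on a potential. -/
lemma IsBoolSpectrum.exists_push_eq_zero_aux {A : ℝ} (N : ℕ) : ∀ {a : G → ℝ},
    IsBoolSpectrum a → ∑ S, |a S| ≤ A → ∀ α, (∀ S, |a S| ≤ |a α|) →
    ∑ S, |a S| + 4 / 3 * A * (1 - |a α|) ≤ N →
    ∃ (φ : G →ₗ[ZMod 2] G) (ψ : AddChar G ℝ),
      Module.finrank (ZMod 2) (LinearMap.ker φ) ≤ N ∧ ∀ T, T ≠ 0 → push φ ψ a T = 0 := by
  induction N with
  | zero =>
    intro a ha hA α hα hΦ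
    have h1 := ha.one_le_sum_abs
    have h2 := ha.abs_le_one α
    have : 0 ≤ 4 / 3 * A * (1 - |a α|) :=
      mul_nonneg (by linarith) (by linarith)
    norm_num at hΦ
    linarith
  | succ N ih =>
    intro a ha hA α hα hΦ
    have h1 := ha.one_le_sum_abs
    by_cases hex : ∃ β, β ≠ α ∧ a β ≠ 0
    · obtain ⟨β₀, hβ₀, hβ₀'⟩ := hex
      obtain ⟨β, hβmem, hβ⟩ := Finset.exists_max_image (Finset.univ.erase α) (fun S => |a S|)
        ⟨β₀, by simp [hβ₀]⟩
      replace hβ : ∀ S, S ≠ α → |a S| ≤ |a β| := fun S hS => hβ S (by simp [hS])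
      have hαβ : α ≠ β := ((Finset.mem_erase.mp hβmem).1).symm
      have hβ0 : 0 < |a β| := (abs_pos.mpr hβ₀').trans_le (hβ _ hβ₀)
      obtain ⟨b, hb, hab⟩ : ∃ b : ℝ, (b = 1 ∨ b = -1) ∧ b * (a α * a β) = |a α| * |a β| := by
        rw [← abs_mul]
        rcases abs_choice (a α * a β) with h | h
        · exact ⟨1, Or.inl rfl, by rw [h, one_mul]⟩
        · exact ⟨-1, Or.inr rfl, by rw [h]; ring⟩
      have hγ : α + β ≠ 0 := by
        intro h
        apply hαβ
        rw [← add_add_self α β, h, zero_add]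
      obtain ⟨l, ψ, hl, hpush⟩ := exists_fold hγ hb
      have hdrop := ha.sum_abs_fold_le hαβ hα hβ (abs_pos.mp hβ0) hb hab
      rw [← sum_abs_fold a hb hl] at hdrop
      set a' := push (foldMap l (α + β)) ψ a with ha'def
      have ha' : IsBoolSpectrum a' := isBoolSpectrum_push ha _ _
      have hsum : ∑ T, |a' T| ≤ ∑ T, |a T| - 2 * |a α| := by
        simp_rw [ha'def, hpush]
        linarith
      obtain ⟨α', -, hα'⟩ := Finset.exists_max_image Finset.univ (fun S => |a' S|) ⟨0, by simp⟩
      replace hα' : ∀ S, |a' S| ≤ |a' α'| := fun S => hα' S (Finset.mem_univ _)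
      have hbabs : |b| = 1 := by rcases hb with rfl | rfl <;> simp
      have hmax : |a α| + |a β| ≤ |a' α'| := by
        have hadd : ∀ u v : ℝ, b * (u * v) = |u| * |v| → |u + b * v| = |u| + |v| := by
          intro u v h
          rw [← abs_of_nonneg (add_nonneg (abs_nonneg u) (abs_nonneg v)), ← sq_eq_sq_iff_abs_eq_abs]
          have hb2 : b ^ 2 = 1 := by rw [← sq_abs, hbabs, one_pow]
          linear_combination 2 * h + v ^ 2 * hb2 - sq_abs u - sq_abs v
        by_cases h0 : l α = 0
        · refine le_trans (le_of_eq ?_) (hα' α)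
          rw [ha'def, hpush, if_pos h0, ← hadd _ _ hab]
          rw [add_comm α β, ← add_assoc, add_comm α β, add_add_self]
        · have hz : ∀ z w : ZMod 2, z + w = 1 → z ≠ 0 → w = 0 := by decide
          have h0' : l β = 0 := hz _ _ (by rw [← map_add, hl]) h0
          refine le_trans (le_of_eq ?_) (hα' β)
          rw [ha'def, hpush, if_pos h0', ← add_assoc, add_comm β α, add_add_self,
            hadd (a β) (a α) (by rw [mul_comm (a β), hab, mul_comm]), add_comm]
      have hpot : ∑ T, |a' T| + 4 / 3 * A * (1 - |a' α'|) ≤ N := by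
        push_cast at hΦ
        have hA0 : 0 < A := by linarith
        have h3 : A * (|a α| + |a β|) ≤ A * |a' α'| := mul_le_mul_of_nonneg_left hmax hA0.le
        by_cases hhalf : |a α| ≤ 1 / 2
        · have h4 : 3 / 4 ≤ |a β| * A := by
            have h5 : (1 : ℝ) ≤ |a α| ^ 2 + |a β| * ∑ S, |a S| := by
              rw [← ha.sum_sq, ← Finset.add_sum_erase _ _ (Finset.mem_univ α), sq_abs,
                Finset.mul_sum]
              gcongr
              refine (Finset.sum_le_sum fun S hS => ?_).trans
                (Finset.sum_le_sum_of_subset_of_nonneg (Finset.erase_subset α _)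
                  fun S _ _ => mul_nonneg hβ0.le (abs_nonneg _))
              rw [← sq_abs, sq]
              exact mul_le_mul_of_nonneg_right (hβ S (Finset.mem_erase.mp hS).1) (abs_nonneg _)
            have h6 := mul_le_mul_of_nonneg_left hA hβ0.le
            nlinarith [abs_nonneg (a α)]
          nlinarith [abs_nonneg (a α)]
        · nlinarith [mul_pos hA0 hβ0]
      obtain ⟨φ', ψ', hker, hzero⟩ := ih ha' (by linarith [abs_nonneg (a α)]) α' hα' hpot
      simp_rw [ha'def, push_push] at hzero
      refine ⟨_, _, ?_, hzero⟩
      have := finrank_ker_comp_le (foldMap l (α + β)) φ'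
      have := finrank_ker_foldMap_le l (α + β)
      omega
    · push Not at hex
      by_cases hα0 : α = 0
      · subst hα0
        refine ⟨LinearMap.id, 1, by rw [LinearMap.ker_id, finrank_bot]; omega, fun T hT => ?_⟩
        refine Finset.sum_eq_zero fun S hS => ?_
        have : S = T := by simpa using hS
        rw [this, hex T hT, mul_zero]
      · obtain ⟨l, ψ, hl, hpush⟩ := exists_fold hα0 (Or.inl rfl)
        refine ⟨foldMap l α, ψ, (finrank_ker_foldMap_le l α).trans (by omega), fun T hT => ?_⟩
        rw [hpush]
        split_ifs with h0
        · have hTα : T ≠ α := by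
            rintro rfl
            simp [hl] at h0
          rw [hex T hTα, hex (T + α) (by simpa using hT)]
          ring
        · rfl

/-- A `±1`-valued function becomes constant on an affine subspace of codimension linear in its
spectral norm. -/
lemma IsBoolSpectrum.exists_push_eq_zero {a : G → ℝ} (ha : IsBoolSpectrum a) :
    ∃ (φ : G →ₗ[ZMod 2] G) (ψ : AddChar G ℝ),
      (Module.finrank (ZMod 2) (LinearMap.ker φ) : ℝ) ≤ 7 / 3 * ∑ S, |a S| + 1 ∧
        ∀ T, T ≠ 0 → push φ ψ a T = 0 := by
  obtain ⟨α, -, hα⟩ := Finset.exists_max_image Finset.univ (fun S => |a S|) ⟨0, by simp⟩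
  have h1 := ha.one_le_sum_abs
  obtain ⟨φ, ψ, hker, hzero⟩ := IsBoolSpectrum.exists_push_eq_zero_aux
    ⌈7 / 3 * ∑ S, |a S|⌉₊ ha le_rfl α (fun S => hα S (Finset.mem_univ _))
    (le_trans (by nlinarith [abs_nonneg (a α)]) (Nat.le_ceil _))
  refine ⟨φ, ψ, ?_, hzero⟩
  have h2 : (Module.finrank (ZMod 2) (LinearMap.ker φ) : ℝ) ≤ ⌈7 / 3 * ∑ S, |a S|⌉₊ := by
    exact_mod_cast hker
  linarith [Nat.ceil_lt_add_one (show 0 ≤ 7 / 3 * ∑ S, |a S| by linarith)]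

lemma push_eq_sum_supp (φ : G →ₗ[ZMod 2] G) (ψ : AddChar G ℝ) (a : G → ℝ) (T : G) :
    push φ ψ a T = ∑ S ∈ supp a with φ S = T, ψ S * a S := by
  refine (Finset.sum_subset (Finset.filter_subset_filter _ (Finset.subset_univ _))
    fun S hS hS' => ?_).symm
  have : a S = 0 := by
    by_contra h
    exact hS' (Finset.mem_filter.mpr ⟨mem_supp.mpr h, (Finset.mem_filter.mp hS).2⟩)
  rw [this, mul_zero]

/-- If a pushforward vanishes away from `0`, then it merges the nonzero support points. -/
lemma two_mul_card_image_supp_le {a : G → ℝ} {φ : G →ₗ[ZMod 2] G} {ψ : AddChar G ℝ}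
    (h : ∀ T, T ≠ 0 → push φ ψ a T = 0) :
    2 * (((supp a).image φ).erase 0).card ≤ ((supp a).erase 0).card := by
  refine (Finset.mul_card_image_le_card_of_maps_to
    (s := (supp a).filter fun S => φ S ≠ 0) (f := φ) ?_ 2 ?_).trans (Finset.card_le_card ?_)
  · intro S hS
    rw [Finset.mem_filter] at hS
    exact Finset.mem_erase.mpr ⟨hS.2, Finset.mem_image_of_mem _ hS.1⟩
  · intro T hT
    obtain ⟨hT0, hT⟩ := Finset.mem_erase.mp hT
    obtain ⟨S, hS, hST⟩ := Finset.mem_image.mp hT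
    refine Finset.one_lt_card.mpr ⟨S, ?_, ?_⟩
    · simp [hS, hST, hT0]
    by_contra! hcon
    have hz := h T hT0
    rw [push_eq_sum_supp, Finset.sum_eq_single S] at hz
    · exact mul_ne_zero (fun h0 => by simpa [h0] using addChar_mul_self ψ S) (mem_supp.mp hS) hz
    · intro S' hS' hne
      refine absurd (hcon S' ?_).symm hne
      obtain ⟨h1, h2⟩ := Finset.mem_filter.mp hS'
      simp [h1, h2, hT0]
    · intro hS'
      exact absurd (Finset.mem_filter.mpr ⟨hS, hST⟩) hS'
  · intro S hS
    rw [Finset.mem_filter] at hS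
    refine Finset.mem_erase.mpr ⟨?_, hS.1⟩
    rintro rfl
    exact hS.2 (map_zero φ)

/-- The spectral norm of a nonconstant `±1`-valued function in terms of its weight and the size
of its support. -/
lemma IsBoolSpectrum.sum_abs_le {a : G → ℝ} (ha : IsBoolSpectrum a)
    (hs : ((supp a).erase 0).Nonempty) :
    1 / 2 ≤ √(((supp a).erase 0).card * ((1 - a 0) / 2)) ∧
      ∑ S, |a S| ≤ 4 * √(((supp a).erase 0).card * ((1 - a 0) / 2)) := by
  set δ := (1 - a 0) / 2 with hδ
  set s : ℝ := (((supp a).erase 0).card : ℝ) with hs'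
  have hs1 : 1 ≤ s := by
    rw [hs']
    exact_mod_cast hs.card_pos
  have h0 := ha.abs_le_one 0
  have h0' := abs_le.mp h0
  have hsum : ∑ S ∈ (supp a).erase 0, a S ^ 2 ≤ 4 * δ := by
    have h1 := Finset.add_sum_erase Finset.univ (fun S => a S ^ 2) (Finset.mem_univ 0)
    rw [ha.sum_sq] at h1
    have h2 : ∑ S ∈ (supp a).erase 0, a S ^ 2 ≤ ∑ S ∈ Finset.univ.erase 0, a S ^ 2 :=
      Finset.sum_le_sum_of_subset_of_nonneg (Finset.erase_subset_erase _ (Finset.subset_univ _))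
        fun _ _ _ => sq_nonneg _
    nlinarith
  set L := ∑ S ∈ Finset.univ.erase 0, |a S| with hL
  have hLeq : L = ∑ S ∈ (supp a).erase 0, |a S| := by
    refine (Finset.sum_subset (Finset.erase_subset_erase _ (Finset.subset_univ _))
      fun S hS hS' => ?_).symm
    have : a S = 0 := by
      by_contra h
      exact hS' (Finset.mem_erase.mpr ⟨(Finset.mem_erase.mp hS).1, mem_supp.mpr h⟩)
    rw [this, abs_zero]
  have hLsq : L ^ 2 ≤ 4 * (s * δ) := by
    rw [hLeq]
    refine sq_sum_le_card_mul_sum_sq.trans ?_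
    simp_rw [sq_abs]
    nlinarith
  have hL0 : 0 ≤ L := Finset.sum_nonneg fun _ _ => abs_nonneg _
  have hLsqrt : L ≤ 2 * √(s * δ) := by
    rw [show (2 : ℝ) = √4 by rw [show (4 : ℝ) = 2 ^ 2 by norm_num]; simp,
      ← Real.sqrt_mul (by norm_num)]
    exact Real.le_sqrt_of_sq_le hLsq
  have hdich : 2 * |a 0| ≤ L := by
    obtain ⟨γ, hγ, hmax⟩ := Finset.exists_max_image _ (fun S => |a S|) hs
    obtain ⟨hγ0, hγ⟩ := Finset.mem_erase.mp hγ
    replace hmax : ∀ S, S ≠ 0 → |a S| ≤ |a γ| := by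
      intro S hS
      by_cases h : a S = 0
      · rw [h, abs_zero]
        exact abs_nonneg _
      · exact hmax S (Finset.mem_erase.mpr ⟨hS, mem_supp.mpr h⟩)
    have hpos : 0 < |a γ| := abs_pos.mpr (mem_supp.mp hγ)
    have hconv := ha γ
    rw [if_neg hγ0, ← Finset.add_sum_erase _ _ (Finset.mem_univ 0),
      ← Finset.add_sum_erase _ _ (Finset.mem_erase.mpr ⟨hγ0, Finset.mem_univ γ⟩), zero_add,
      ZModModule.add_self] at hconv
    have h1 : |2 * (a 0 * a γ)| ≤ ∑ S ∈ (Finset.univ.erase 0).erase γ, |a S| * |a γ| := by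
      have : 2 * (a 0 * a γ) = -∑ S ∈ (Finset.univ.erase 0).erase γ, a S * a (S + γ) := by
        linarith
      rw [this, abs_neg]
      refine (Finset.abs_sum_le_sum_abs _ _).trans (Finset.sum_le_sum fun S hS => ?_)
      rw [abs_mul]
      refine mul_le_mul_of_nonneg_left (hmax _ fun h => ?_) (abs_nonneg _)
      apply (Finset.mem_erase.mp hS).1
      rw [← add_add_self S γ, h, zero_add]
    have h2 : ∑ S ∈ (Finset.univ.erase 0).erase γ, |a S| ≤ L :=
      Finset.sum_le_sum_of_subset_of_nonneg (Finset.erase_subset _ _) fun _ _ _ => abs_nonneg _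
    rw [← Finset.sum_mul, abs_mul, abs_mul, abs_two, ← mul_assoc] at h1
    exact (le_of_mul_le_mul_right h1 hpos).trans h2
  have hhalf : 1 / 2 ≤ √(s * δ) := by
    by_cases h : 1 / 2 ≤ |a 0|
    · linarith
    · apply Real.le_sqrt_of_sq_le
      have : a 0 < 1 / 2 := (le_abs_self _).trans_lt (not_le.mp h)
      nlinarith
  refine ⟨hhalf, ?_⟩
  rw [← Finset.add_sum_erase _ _ (Finset.mem_univ 0)]
  linarith

section Averaging

variable {X : Type*} [Fintype X] {χ : X → AddChar G ℝ}

lemma sum_push_zero (hχ : ∀ S, ∑ x, χ x S = if S = 0 then (Fintype.card X : ℝ) else 0)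
    (φ : G →ₗ[ZMod 2] G) (a : G → ℝ) :
    ∑ x, push φ (χ x) a 0 = Fintype.card X * a 0 := by
  unfold push
  rw [Finset.sum_comm]
  simp_rw [← Finset.sum_mul, hχ]
  rw [Finset.sum_eq_single 0]
  · simp
  · intro S _ hS
    simp [hS]
  · simp

lemma sum_push_sq (hχ : ∀ S, ∑ x, χ x S = if S = 0 then (Fintype.card X : ℝ) else 0)
    (φ : G →ₗ[ZMod 2] G) (a : G → ℝ) (T : G) :
    ∑ x, push φ (χ x) a T ^ 2 = Fintype.card X * ∑ S with φ S = T, a S ^ 2 := by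
  have h1 : ∀ x, push φ (χ x) a T ^ 2
      = ∑ S with φ S = T, ∑ S' with φ S' = T, χ x (S + S') * (a S * a S') := by
    intro x
    rw [push, sq, Finset.sum_mul_sum]
    refine Finset.sum_congr rfl fun S _ => Finset.sum_congr rfl fun S' _ => ?_
    rw [AddChar.map_add_eq_mul]
    ring
  simp_rw [h1]
  rw [Finset.sum_comm, Finset.mul_sum]
  refine Finset.sum_congr rfl fun S hS => ?_
  rw [Finset.sum_comm]
  simp_rw [← Finset.sum_mul, hχ]
  rw [Finset.sum_eq_single S]
  · rw [if_pos (ZModModule.add_self S), sq]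
  · intro S' _ hne
    rw [if_neg, zero_mul]
    intro h
    apply hne
    rw [← add_add_self S' S, add_comm S' S, h, zero_add]
  · exact fun h => absurd hS h

/-- A bucket with `m` support points survives a random twist with probability at least `1 / m`. -/
lemma card_le_card_mul_card_push_ne_zero
    (hχ : ∀ S, ∑ x, χ x S = if S = 0 then (Fintype.card X : ℝ) else 0)
    (φ : G →ₗ[ZMod 2] G) (a : G → ℝ) {T : G} (hT : T ∈ (supp a).image φ) :
    (Fintype.card X : ℝ) ≤ ((supp a).filter fun S => φ S = T).card *
      ((Finset.univ.filter fun x => push φ (χ x) a T ≠ 0).card : ℝ) := by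
  obtain ⟨S, hS, hST⟩ := Finset.mem_image.mp hT
  set F := (supp a).filter fun S => φ S = T with hF
  have hpos : 0 < ∑ S ∈ F, a S ^ 2 :=
    Finset.sum_pos (fun S hS => by
      have := mem_supp.mp (Finset.mem_filter.mp hS).1
      positivity) ⟨S, Finset.mem_filter.mpr ⟨hS, hST⟩⟩
  have hsum := sum_push_sq hχ φ a T
  have hle : ∑ S ∈ F, a S ^ 2 ≤ ∑ S with φ S = T, a S ^ 2 :=
    Finset.sum_le_sum_of_subset_of_nonneg
      (Finset.filter_subset_filter _ (Finset.subset_univ _)) fun _ _ _ => sq_nonneg _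
  have hpt : ∀ x, push φ (χ x) a T ^ 2
      ≤ if push φ (χ x) a T ≠ 0 then F.card * ∑ S ∈ F, a S ^ 2 else 0 := by
    intro x
    split_ifs with h
    · rw [push_eq_sum_supp]
      refine sq_sum_le_card_mul_sum_sq.trans (le_of_eq ?_)
      congr 1
      refine Finset.sum_congr rfl fun S _ => ?_
      rw [mul_pow, sq (χ x S), addChar_mul_self, one_mul]
    · rw [not_not.mp h]
      simp
  have h2 := Finset.sum_le_sum fun x (_ : x ∈ Finset.univ) => hpt x
  rw [hsum, ← Finset.sum_filter, Finset.sum_const, nsmul_eq_mul] at h2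
  refine le_of_mul_le_mul_right ?_ hpos
  calc (Fintype.card X : ℝ) * ∑ S ∈ F, a S ^ 2
      ≤ Fintype.card X * ∑ S with φ S = T, a S ^ 2 :=
        mul_le_mul_of_nonneg_left hle (Nat.cast_nonneg _)
    _ ≤ _ := h2
    _ = _ := by ring

lemma supp_push_subset (φ : G →ₗ[ZMod 2] G) (ψ : AddChar G ℝ) (a : G → ℝ) :
    supp (push φ ψ a) ⊆ (supp a).image φ := by
  intro T hT
  rw [mem_supp, push_eq_sum_supp] at hT
  obtain ⟨S, hS, -⟩ := Finset.exists_ne_zero_of_sum_ne_zero hT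
  rw [Finset.mem_filter] at hS
  exact hS.2 ▸ Finset.mem_image_of_mem φ hS.1

/-- The expected number of surviving nonzero buckets. -/
lemma card_sq_le_sum_card_supp_push
    (hχ : ∀ S, ∑ x, χ x S = if S = 0 then (Fintype.card X : ℝ) else 0)
    (φ : G →ₗ[ZMod 2] G) (a : G → ℝ) :
    (Fintype.card X : ℝ) * (((supp a).image φ).erase 0).card ^ 2
      ≤ (supp a).card * ∑ x, (((supp (push φ (χ x) a)).erase 0).card : ℝ) := by
  set B := ((supp a).image φ).erase 0 with hB
  have hswap : ∑ x, (((supp (push φ (χ x) a)).erase 0).card : ℝ)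
      = ∑ T ∈ B, ((Finset.univ.filter fun x => push φ (χ x) a T ≠ 0).card : ℝ) := by
    have h1 : ∀ x, (((supp (push φ (χ x) a)).erase 0).card : ℝ)
        = ∑ T ∈ B, if push φ (χ x) a T ≠ 0 then 1 else 0 := by
      intro x
      rw [← Finset.sum_filter, Finset.sum_const, nsmul_eq_mul, mul_one]
      congr 2
      ext T
      simp only [hB, Finset.mem_filter, Finset.mem_erase, mem_supp]
      constructor
      · exact fun h => ⟨⟨h.1, supp_push_subset _ _ _ (mem_supp.mpr h.2)⟩, h.2⟩
      · exact fun h => ⟨h.1.1, h.2⟩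
    simp_rw [h1]
    rw [Finset.sum_comm]
    refine Finset.sum_congr rfl fun T _ => ?_
    rw [← Finset.sum_filter, Finset.sum_const, nsmul_eq_mul, mul_one]
  rw [hswap]
  set m : G → ℝ := fun T => ((supp a).filter fun S => φ S = T).card with hm
  have hmpos : ∀ T ∈ B, 0 < m T := by
    intro T hT
    obtain ⟨S, hS, hST⟩ := Finset.mem_image.mp (Finset.mem_erase.mp hT).2
    simp only [hm, Nat.cast_pos]
    exact Finset.card_pos.mpr ⟨S, Finset.mem_filter.mpr ⟨hS, hST⟩⟩
  have hmsum : ∑ T ∈ B, m T ≤ (supp a).card := by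
    have h1 : ((supp a).card : ℝ) = ∑ T ∈ (supp a).image φ, m T := by
      rw [Finset.card_eq_sum_card_image φ (supp a)]
      push_cast
      rfl
    rw [h1]
    exact Finset.sum_le_sum_of_subset_of_nonneg (Finset.erase_subset _ _)
      fun _ _ _ => Nat.cast_nonneg _
  have hcs := Finset.sum_mul_sq_le_sq_mul_sq B (fun T => √(m T)) fun T => 1 / √(m T)
  have h1 : ∑ T ∈ B, √(m T) * (1 / √(m T)) = B.card := by
    rw [Finset.card_eq_sum_ones]
    push_cast
    refine Finset.sum_congr rfl fun T hT => ?_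
    have := Real.sqrt_pos.mpr (hmpos T hT)
    field_simp
  have h2 : ∑ T ∈ B, √(m T) ^ 2 = ∑ T ∈ B, m T :=
    Finset.sum_congr rfl fun T hT => Real.sq_sqrt (hmpos T hT).le
  have h3 : ∑ T ∈ B, (1 / √(m T)) ^ 2 = ∑ T ∈ B, 1 / m T :=
    Finset.sum_congr rfl fun T hT => by rw [div_pow, one_pow, Real.sq_sqrt (hmpos T hT).le]
  rw [h1, h2, h3] at hcs
  have hX : (Fintype.card X : ℝ) * ∑ T ∈ B, 1 / m T
      ≤ ∑ T ∈ B, ((Finset.univ.filter fun x => push φ (χ x) a T ≠ 0).card : ℝ) := by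
    rw [Finset.mul_sum]
    refine Finset.sum_le_sum fun T hT => ?_
    rw [mul_one_div, div_le_iff₀ (hmpos T hT), mul_comm]
    exact card_le_card_mul_card_push_ne_zero hχ φ a (Finset.mem_erase.mp hT).2
  have hinv : 0 ≤ ∑ T ∈ B, 1 / m T :=
    Finset.sum_nonneg fun T hT => (one_div_pos.mpr (hmpos T hT)).le
  have hB2 : (B.card : ℝ) ^ 2 ≤ (supp a).card * ∑ T ∈ B, 1 / m T :=
    hcs.trans (mul_le_mul_of_nonneg_right hmsum hinv)
  calc (Fintype.card X : ℝ) * (B.card : ℝ) ^ 2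
      ≤ Fintype.card X * ((supp a).card * ∑ T ∈ B, 1 / m T) :=
        mul_le_mul_of_nonneg_left hB2 (Nat.cast_nonneg _)
    _ = (supp a).card * (Fintype.card X * ∑ T ∈ B, 1 / m T) := by ring
    _ ≤ _ := mul_le_mul_of_nonneg_left hX (Nat.cast_nonneg _)

end Averaging

/-- A logarithmic potential on the number of remaining buckets. -/
def logPotential (N : ℕ) : ℝ := if N = 0 then 0 else 1 + Real.log N

lemma sub_div_le_logPotential_sub {M N : ℕ} (hN : 0 < N) :
    ((N : ℝ) - M) / N ≤ logPotential N - logPotential M := by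
  have hN' : (0 : ℝ) < N := Nat.cast_pos.mpr hN
  unfold logPotential
  rw [if_neg hN.ne']
  split_ifs with hM
  · subst hM
    have := Real.log_nonneg (show (1 : ℝ) ≤ N by exact_mod_cast hN)
    rw [Nat.cast_zero, sub_zero, div_self hN'.ne']
    linarith
  · have hM' : (0 : ℝ) < M := Nat.cast_pos.mpr (Nat.pos_of_ne_zero hM)
    have h := Real.one_sub_inv_le_log_of_pos (div_pos hN' hM')
    rw [Real.log_div hN'.ne' hM'.ne', inv_div] at h
    rw [sub_div, div_self hN'.ne']
    linarith

section Rank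

variable {X : Type*} [Fintype X] [Nonempty X] {χ : X → AddChar G ℝ}

/-- One round: some twist followed by a further pushforward removes buckets at a cheap rate. -/
lemma IsBoolSpectrum.exists_merge {a : G → ℝ} (ha : IsBoolSpectrum a)
    (hχ : ∀ S, ∑ x, χ x S = if S = 0 then (Fintype.card X : ℝ) else 0)
    (φ : G →ₗ[ZMod 2] G) (hB : (((supp a).image φ).erase 0).Nonempty) :
    ∃ φ' : G →ₗ[ZMod 2] G,
      (((supp a).image (φ' ∘ₗ φ)).erase 0).card < (((supp a).image φ).erase 0).card ∧
      (Module.finrank (ZMod 2) (LinearMap.ker φ') : ℝ) ≤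
        48 * √((supp a).card * ((1 - a 0) / 2)) *
          (((((supp a).image φ).erase 0).card - (((supp a).image (φ' ∘ₗ φ)).erase 0).card)
            / (((supp a).image φ).erase 0).card) := by
  set B := ((supp a).image φ).erase 0 with hBdef
  set N : ℝ := (B.card : ℝ) with hNdef
  set k : ℝ := ((supp a).card : ℝ) with hk
  set δ := (1 - a 0) / 2 with hδdef
  have hN : 0 < N := Nat.cast_pos.mpr hB.card_pos
  have hcard : (0 : ℝ) < Fintype.card X := Nat.cast_pos.mpr Fintype.card_pos
  have hδ : 0 < δ := by
    obtain ⟨T, hT⟩ := hB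
    obtain ⟨hT0, hT⟩ := Finset.mem_erase.mp hT
    obtain ⟨S, hS, rfl⟩ := Finset.mem_image.mp hT
    have hS0 : S ≠ 0 := by
      rintro rfl
      exact hT0 (map_zero φ)
    have h1 := ha.sum_sq
    rw [← Finset.add_sum_erase _ _ (Finset.mem_univ 0)] at h1
    have h2 : a S ^ 2 ≤ ∑ S ∈ Finset.univ.erase 0, a S ^ 2 :=
      Finset.single_le_sum (f := fun S => a S ^ 2) (fun _ _ => sq_nonneg _)
        (Finset.mem_erase.mpr ⟨hS0, Finset.mem_univ S⟩)
    have h3 : 0 < a S ^ 2 := by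
      have := mem_supp.mp hS
      positivity
    have h4 : a 0 < 1 := by nlinarith
    rw [hδdef]
    linarith
  obtain ⟨x, hx⟩ : ∃ x, N ^ 2 * ((1 - push φ (χ x) a 0) / 2)
      < 2 * (k * δ) * (((supp (push φ (χ x) a)).erase 0).card : ℝ) := by
    by_contra! hcon
    have h1 := Finset.sum_le_sum fun x (_ : x ∈ Finset.univ) => hcon x
    rw [← Finset.mul_sum, ← Finset.mul_sum, ← Finset.sum_div, Finset.sum_sub_distrib,
      sum_push_zero hχ, Finset.sum_const, Finset.card_univ, nsmul_eq_mul, mul_one] at h1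
    have h2 := card_sq_le_sum_card_supp_push hχ φ a
    have h3 := mul_le_mul_of_nonneg_left h2 (by positivity : (0 : ℝ) ≤ 2 * δ)
    have h4 : 0 < Fintype.card X * N ^ 2 * δ := by positivity
    have h5 : N ^ 2 * ((Fintype.card X - Fintype.card X * a 0) / 2)
        = Fintype.card X * N ^ 2 * δ := by
      rw [hδdef]
      ring
    rw [h5] at h1
    nlinarith
  set b := push φ (χ x) a with hb
  have hbs : IsBoolSpectrum b := isBoolSpectrum_push ha _ _
  set s : ℝ := (((supp b).erase 0).card : ℝ) with hs
  have hδx : 0 ≤ (1 - b 0) / 2 := by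
    have := (abs_le.mp (hbs.abs_le_one 0)).2
    linarith
  have hkδ : 0 ≤ k * δ := mul_nonneg (Nat.cast_nonneg _) hδ.le
  have hspos : 0 < s := by
    by_contra h
    have hs0 : 0 ≤ s := Nat.cast_nonneg _
    have : s = 0 := le_antisymm (not_lt.mp h) hs0
    rw [this, mul_zero] at hx
    exact absurd hx (not_lt.mpr (by positivity))
  have hne : ((supp b).erase 0).Nonempty := Finset.card_pos.mp (Nat.cast_pos.mp hspos)
  obtain ⟨hq, hL1⟩ := hbs.sum_abs_le hne
  obtain ⟨φ', ψ', hker, hzero⟩ := hbs.exists_push_eq_zero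
  have hmerge := two_mul_card_image_supp_le hzero
  set N' := (((supp a).image (φ' ∘ₗ φ)).erase 0).card with hN'
  have hNN : 2 * N' + ((supp b).erase 0).card ≤ 2 * B.card := by
    have hsub : (supp b).erase 0 ⊆ B := Finset.erase_subset_erase _ (supp_push_subset _ _ _)
    have h1 : ((supp a).image (φ' ∘ₗ φ)).erase 0
        ⊆ ((supp b).image φ').erase 0 ∪ (B \ (supp b).erase 0).image φ' := by
      intro T hT
      obtain ⟨hT0, hT⟩ := Finset.mem_erase.mp hT
      obtain ⟨S, hS, rfl⟩ := Finset.mem_image.mp hT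
      rw [LinearMap.comp_apply] at hT0 ⊢
      by_cases h : φ S ∈ supp b
      · exact Finset.mem_union_left _
          (Finset.mem_erase.mpr ⟨hT0, Finset.mem_image_of_mem _ h⟩)
      · refine Finset.mem_union_right _ (Finset.mem_image_of_mem _ ?_)
        refine Finset.mem_sdiff.mpr ⟨Finset.mem_erase.mpr ⟨?_, Finset.mem_image_of_mem _ hS⟩,
          fun h' => h (Finset.mem_erase.mp h').2⟩
        intro h0
        exact hT0 (by rw [h0, map_zero])
    have h2 := (Finset.card_le_card h1).trans (Finset.card_union_le _ _)
    have h3 : ((B \ (supp b).erase 0).image φ').card ≤ _ := Finset.card_image_le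
    have h4 := Finset.card_sdiff_add_card_eq_card hsub
    omega
  refine ⟨φ', by have := hne.card_pos; omega, ?_⟩
  have hNN' : s ≤ 2 * (N - N') := by
    have : (2 : ℝ) * N' + s ≤ 2 * N := by
      rw [hs, hNdef]
      exact_mod_cast hNN
    linarith
  set q := √(s * ((1 - b 0) / 2)) with hqdef
  have hqle : q ≤ 2 * √(k * δ) * (s / N) := by
    refine Real.sqrt_le_iff.mpr ⟨by positivity, ?_⟩
    have h1 : (2 * √(k * δ) * (s / N)) ^ 2 = 4 * (k * δ) * s ^ 2 / N ^ 2 := by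
      rw [mul_pow, mul_pow, Real.sq_sqrt hkδ]
      ring
    rw [h1, le_div_iff₀ (by positivity)]
    nlinarith [mul_lt_mul_of_pos_left hx hspos, mul_nonneg hkδ (sq_nonneg s)]
  calc (Module.finrank (ZMod 2) (LinearMap.ker φ') : ℝ) ≤ 12 * q := by linarith
    _ ≤ 12 * (2 * √(k * δ) * (s / N)) := by linarith
    _ ≤ 12 * (2 * √(k * δ) * (2 * (N - N') / N)) := by gcongr
    _ = _ := by ring

lemma IsBoolSpectrum.finrank_span_supp_le_aux {a : G → ℝ} (ha : IsBoolSpectrum a)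
    (hχ : ∀ S, ∑ x, χ x S = if S = 0 then (Fintype.card X : ℝ) else 0) (N : ℕ) :
    ∀ φ : G →ₗ[ZMod 2] G, (((supp a).image φ).erase 0).card = N →
      (Module.finrank (ZMod 2) (Submodule.span (ZMod 2) (supp a : Set G)) : ℝ)
        ≤ Module.finrank (ZMod 2) (LinearMap.ker φ)
          + 48 * √((supp a).card * ((1 - a 0) / 2)) * logPotential N := by
  induction N using Nat.strong_induction_on with
  | _ N ih =>
    intro φ hN
    have hfin : Module.Finite (ZMod 2) G := Module.Finite.of_finite
    rcases Nat.eq_zero_or_pos N with h0 | hpos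
    · subst h0
      rw [Finset.card_eq_zero] at hN
      simp only [logPotential, if_true, mul_zero, add_zero, Nat.cast_le]
      refine Submodule.finrank_mono (Submodule.span_le.mpr fun S hS => ?_)
      by_contra h
      have : φ S ∈ ((supp a).image φ).erase 0 :=
        Finset.mem_erase.mpr ⟨h, Finset.mem_image_of_mem _ hS⟩
      rw [hN] at this
      exact absurd this (Finset.notMem_empty _)
    · obtain ⟨φ', hlt, hker⟩ := ha.exists_merge hχ φ (Finset.card_pos.mp (hN ▸ hpos))
      rw [hN] at hlt hker
      have h1 := ih _ hlt (φ' ∘ₗ φ) rfl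
      have h2 : (Module.finrank (ZMod 2) (LinearMap.ker (φ' ∘ₗ φ)) : ℝ)
          ≤ Module.finrank (ZMod 2) (LinearMap.ker φ)
            + Module.finrank (ZMod 2) (LinearMap.ker φ') := by
        exact_mod_cast finrank_ker_comp_le φ φ'
      have h3 := mul_le_mul_of_nonneg_left
        (sub_div_le_logPotential_sub (M := (((supp a).image (φ' ∘ₗ φ)).erase 0).card) hpos)
        (show 0 ≤ 48 * √((supp a).card * ((1 - a 0) / 2)) by positivity)
      rw [mul_sub] at h3
      linarith

/-- The rank of a spectrum in terms of its sparsity and weight. -/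
lemma IsBoolSpectrum.finrank_span_supp_le {a : G → ℝ} (ha : IsBoolSpectrum a)
    (hχ : ∀ S, ∑ x, χ x S = if S = 0 then (Fintype.card X : ℝ) else 0) :
    (Module.finrank (ZMod 2) (Submodule.span (ZMod 2) (supp a : Set G)) : ℝ)
      ≤ 48 * √((supp a).card * ((1 - a 0) / 2)) * (1 + Real.log (supp a).card) := by
  have h := ha.finrank_span_supp_le_aux hχ _ LinearMap.id rfl
  rw [LinearMap.ker_id, finrank_bot, Nat.cast_zero, zero_add] at h
  refine h.trans (mul_le_mul_of_nonneg_left ?_ (by positivity))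
  have hle : (((supp a).image (LinearMap.id : G →ₗ[ZMod 2] G)).erase 0).card ≤ (supp a).card :=
    (Finset.card_le_card (Finset.erase_subset _ _)).trans Finset.card_image_le
  unfold logPotential
  split_ifs with h0
  · have := Real.log_natCast_nonneg (supp a).card
    linarith
  · have : (0 : ℝ) < (((supp a).image (LinearMap.id : G →ₗ[ZMod 2] G)).erase 0).card :=
      Nat.cast_pos.mpr (Nat.pos_of_ne_zero h0)
    gcongr

end Rank

end Spectrum

section Cube

variable {n : ℕ}

/-- The character of `F₂ⁿ` given by a point of the hypercube. -/
def cubeChar (x : Fin n → Bool) : AddChar (Fin n → ZMod 2) ℝ where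
  toFun v := ∏ i, if x i then sgn (v i) else 1
  map_zero_eq_one' := by simp
  map_add_eq_mul' u v := by
    rw [← Finset.prod_mul_distrib]
    refine Finset.prod_congr rfl fun i _ => ?_
    split_ifs
    · rw [Pi.add_apply, AddChar.map_add_eq_mul]
    · rw [one_mul]

lemma cubeChar_apply (x : Fin n → Bool) (v : Fin n → ZMod 2) :
    cubeChar x v = ∏ i, if x i then sgn (v i) else 1 := rfl

lemma cubeChar_eq_prod_signv (x : Fin n → Bool) (v : Fin n → ZMod 2) :
    cubeChar x v = ∏ i with v i ≠ 0, signv (x i) := by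
  rw [cubeChar_apply, Finset.prod_filter]
  refine Finset.prod_congr rfl fun i _ => ?_
  have hz : ∀ z : ZMod 2, z = 0 ∨ z = 1 := by decide
  rcases hz (v i) with h | h <;> cases hx : x i <;> simp [h, signv, sgn_one]

lemma sum_cubeChar (v : Fin n → ZMod 2) :
    ∑ x : Fin n → Bool, cubeChar x v
      = if v = 0 then (Fintype.card (Fin n → Bool) : ℝ) else 0 := by
  have h := Finset.prod_univ_sum (fun _ : Fin n => (Finset.univ : Finset Bool))
    (fun i b => if b then sgn (v i) else 1)
  rw [Fintype.piFinset_univ] at h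
  simp_rw [cubeChar_apply]
  rw [← h]
  split_ifs with hv
  · subst hv
    norm_num [Fintype.card_pi]
  · obtain ⟨i, hi⟩ := Function.ne_iff.mp hv
    have hz : ∀ z : ZMod 2, z ≠ 0 → z = 1 := by decide
    refine Finset.prod_eq_zero (Finset.mem_univ i) ?_
    simp [hz _ hi, sgn_one]

lemma sum_cubeChar_mul (x y : Fin n → Bool) :
    ∑ v : Fin n → ZMod 2, cubeChar x v * cubeChar y v = if x = y then (2 : ℝ) ^ n else 0 := by
  have h := Finset.prod_univ_sum (fun _ : Fin n => (Finset.univ : Finset (ZMod 2)))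
    (fun i z => (if x i then sgn z else 1) * (if y i then sgn z else 1))
  rw [Fintype.piFinset_univ] at h
  simp_rw [cubeChar_apply, ← Finset.prod_mul_distrib]
  rw [← h]
  have hsum : ∀ g : ZMod 2 → ℝ, ∑ z, g z = g 0 + g 1 := fun g => Fin.sum_univ_two g
  simp_rw [hsum]
  split_ifs with hxy
  · subst hxy
    rw [Finset.prod_congr rfl (g := fun _ => (2 : ℝ)), Finset.prod_const, Finset.card_univ,
      Fintype.card_fin]
    intro i _
    cases x i <;> norm_num [sgn_one]
  · obtain ⟨i, hi⟩ := Function.ne_iff.mp hxy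
    refine Finset.prod_eq_zero (Finset.mem_univ i) ?_
    cases hx : x i <;> cases hy : y i <;> simp_all [sgn_one]

/-- The Fourier transform indexed by vectors of `F₂ⁿ`. -/
def spectrum (f : (Fin n → Bool) → ℝ) (v : Fin n → ZMod 2) : ℝ :=
  (∑ x, f x * cubeChar x v) / 2 ^ n

lemma isBoolSpectrum_spectrum {f : (Fin n → Bool) → ℝ} (hf : IsBooleanFunc f) :
    IsBoolSpectrum (spectrum f) := by
  intro γ
  have hsq : ∀ x, f x * f x = 1 := by
    intro x
    rcases hf x with h | h <;> simp [h]
  have h1 : ∀ v, spectrum f v * spectrum f (v + γ) = (∑ x, ∑ y, f x * f y * cubeChar y γ *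
      (cubeChar x v * cubeChar y v)) / (2 ^ n * 2 ^ n) := by
    intro v
    rw [spectrum, spectrum, div_mul_div_comm, Finset.sum_mul_sum]
    congr 1
    refine Finset.sum_congr rfl fun x _ => Finset.sum_congr rfl fun y _ => ?_
    rw [AddChar.map_add_eq_mul]
    ring
  simp_rw [h1]
  rw [← Finset.sum_div, Finset.sum_comm]
  have h2 : ∀ x, ∑ v, ∑ y, f x * f y * cubeChar y γ * (cubeChar x v * cubeChar y v)
      = 2 ^ n * cubeChar x γ := by
    intro x
    rw [Finset.sum_comm]
    simp_rw [← Finset.mul_sum, sum_cubeChar_mul]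
    rw [Finset.sum_eq_single x]
    · rw [hsq, if_pos rfl]
      ring
    · intro y _ hy
      rw [if_neg hy.symm, mul_zero]
    · simp
  simp_rw [h2]
  rw [← Finset.mul_sum, sum_cubeChar]
  split_ifs
  · rw [Fintype.card_fun, Fintype.card_bool, Fintype.card_fin]
    push_cast
    exact div_self (by positivity)
  · simp

lemma filter_indicatorVec_ne_zero (S : Finset (Fin n)) :
    (Finset.univ.filter fun i => indicatorVec S i ≠ 0) = S := by
  ext i
  simp [indicatorVec]

lemma indicatorVec_filter_ne_zero (v : Fin n → ZMod 2) :
    indicatorVec (Finset.univ.filter fun i => v i ≠ 0) = v := by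
  funext i
  have hz : ∀ z : ZMod 2, z ≠ 0 → z = 1 := by decide
  by_cases h : v i = 0
  · simp [indicatorVec, h]
  · simp [indicatorVec, hz _ h]

lemma spectrum_indicatorVec (f : (Fin n → Bool) → ℝ) (S : Finset (Fin n)) :
    spectrum f (indicatorVec S) = fourierCoeff f S := by
  simp_rw [spectrum, fourierCoeff, cubeChar_eq_prod_signv, filter_indicatorVec_ne_zero]

lemma indicatorVec_injective : Function.Injective (indicatorVec (n := n)) :=
  Function.LeftInverse.injective
    (g := fun v : Fin n → ZMod 2 => Finset.univ.filter fun i => v i ≠ 0)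
    filter_indicatorVec_ne_zero

lemma supp_spectrum (f : (Fin n → Bool) → ℝ) :
    supp (spectrum f) = (fourierSupport f).image indicatorVec := by
  ext v
  rw [mem_supp, Finset.mem_image]
  constructor
  · intro h
    refine ⟨Finset.univ.filter fun i => v i ≠ 0, ?_, indicatorVec_filter_ne_zero v⟩
    rw [fourierSupport, Finset.mem_filter, ← spectrum_indicatorVec, indicatorVec_filter_ne_zero]
    exact ⟨Finset.mem_univ _, h⟩
  · rintro ⟨S, hS, rfl⟩
    rw [spectrum_indicatorVec]
    exact (Finset.mem_filter.mp hS).2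

lemma card_supp_spectrum (f : (Fin n → Bool) → ℝ) : (supp (spectrum f)).card = sparsity f := by
  rw [supp_spectrum, Finset.card_image_of_injective _ indicatorVec_injective, sparsity]

lemma finrank_span_supp_spectrum (f : (Fin n → Bool) → ℝ) :
    Module.finrank (ZMod 2)
      (Submodule.span (ZMod 2) (supp (spectrum f) : Set (Fin n → ZMod 2))) = fourierRank f := by
  rw [supp_spectrum, Finset.coe_image, fourierRank]

lemma weight_eq_spectrum_zero {f : (Fin n → Bool) → ℝ} (hf : IsBooleanFunc f) :
    weight f = (1 - spectrum f 0) / 2 := by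
  have h1 : ∀ x, f x * cubeChar x 0 = 1 - 2 * if f x = -1 then 1 else 0 := by
    intro x
    rw [AddChar.map_zero_eq_one]
    rcases hf x with h | h <;> norm_num [h]
  have hpow : (0 : ℝ) < 2 ^ n := by positivity
  rw [spectrum, weight]
  simp_rw [h1]
  rw [Finset.sum_sub_distrib, ← Finset.mul_sum, ← Finset.sum_filter]
  simp only [Finset.sum_const, Finset.card_univ, Fintype.card_fun, Fintype.card_bool,
    Fintype.card_fin, nsmul_eq_mul, mul_one]
  push_cast
  field_simp
  ring

/-- The rank is at most of order `√(k δ) log k`. -/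
lemma fourierRank_le {f : (Fin n → Bool) → ℝ} (hf : IsBooleanFunc f) :
    (fourierRank f : ℝ) ≤ 48 * √(sparsity f * weight f) * (1 + Real.log (sparsity f)) := by
  have h := (isBoolSpectrum_spectrum hf).finrank_span_supp_le
    (χ := cubeChar) fun v => by simpa using sum_cubeChar v
  rwa [finrank_span_supp_spectrum, card_supp_spectrum, ← weight_eq_spectrum_zero hf] at h

end Cube

/-- **Theorem (refined Chang's lemma, sparsity threshold).**
There is a universal constant `c > 0` such that every Boolean function
`f : {-1,1}ⁿ → {-1,1}` with `k(f) > 1` satisfies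
`δ(f) ≥ c · r(f)² / (k(f) · (log₂ k(f))²)`. -/
theorem delta_lower_bound_rank_sparsity :
    ∃ c : ℝ, 0 < c ∧
      ∀ (n : ℕ), 0 < n → ∀ f : (Fin n → Bool) → ℝ, IsBooleanFunc f →
        1 < sparsity f →
        c * (fourierRank f : ℝ) ^ 2 /
            ((sparsity f : ℝ) * (Real.logb 2 (sparsity f)) ^ 2) ≤ weight f := by
  refine ⟨1 / 96 ^ 2, by norm_num, fun n _ f hf hk => ?_⟩
  have hk' : (2 : ℝ) ≤ sparsity f := by exact_mod_cast hk
  have hlogb : 1 ≤ Real.logb 2 (sparsity f) := by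
    rw [Real.le_logb_iff_rpow_le (by norm_num) (by linarith), Real.rpow_one]
    exact hk'
  have hlog : Real.log (sparsity f) ≤ Real.logb 2 (sparsity f) := by
    have h2 : Real.log 2 ≤ 1 := by linarith [Real.log_two_lt_d9]
    rw [Real.logb, le_div_iff₀ (Real.log_pos (by norm_num))]
    exact mul_le_of_le_one_right (Real.log_nonneg (by linarith)) h2
  have hw : 0 ≤ weight f := div_nonneg (Nat.cast_nonneg _) (by positivity)
  have hr : (fourierRank f : ℝ)
      ≤ 96 * (√(sparsity f * weight f) * Real.logb 2 (sparsity f)) := by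
    refine (fourierRank_le hf).trans ?_
    nlinarith [Real.sqrt_nonneg (sparsity f * weight f)]
  have hsq := pow_le_pow_left₀ (Nat.cast_nonneg _) hr 2
  rw [mul_pow, mul_pow, Real.sq_sqrt (by positivity)] at hsq
  rw [div_le_iff₀ (by positivity)]
  linarith

end BoolFunc

end
end

section
/- There exists a universal constant c > 0 such that for every positive integer n and every Boolean function f : {-1,1}^n → {-1,1} with k(f) > 1, δ(f) ≥ c · max{ (1/k(f)) · (r(f)/log k(f))^2 , r(f)/(k''(f) · log k(f)) }. -/
open scoped BigOperators
open scoped Classical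

noncomputable section

namespace BoolFunc

/-- The nontrivial additive character `ZMod 2 → {1, -1}`. -/
def sg (a : ZMod 2) : ℝ := if a = 0 then 1 else -1

lemma sg_add (a b : ZMod 2) : sg (a + b) = sg a * sg b := by
  have h : ∀ a : ZMod 2, a = 0 ∨ a = 1 := by decide
  rcases h a with rfl | rfl <;> rcases h b with rfl | rfl <;>
    simp [sg, show (1 : ZMod 2) + 1 = 0 from rfl]

lemma sg_zero : sg 0 = 1 := by simp [sg]

lemma sg_one : sg 1 = -1 := by simp [sg]

lemma sg_eq (a : ZMod 2) : sg a = 1 ∨ sg a = -1 := by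
  unfold sg; split_ifs <;> simp

lemma sg_mul_self (a : ZMod 2) : sg a * sg a = 1 := by
  rcases sg_eq a with h | h <;> rw [h] <;> norm_num

lemma zmod_two_eq_one {a : ZMod 2} (h : a ≠ 0) : a = 1 := by
  revert a; decide

lemma add_self_vec {ι : Type*} (v : ι → ZMod 2) : v + v = 0 := by
  ext i; exact CharTwo.add_self_eq_zero _

lemma sum_sg_dotProduct {n : ℕ} {z : Fin n → ZMod 2} (hz : z ≠ 0) :
    ∑ s : Fin n → ZMod 2, sg (s ⬝ᵥ z) = 0 := by
  obtain ⟨i, hi⟩ := Function.ne_iff.1 hz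
  have h1 : Pi.single i 1 ⬝ᵥ z = 1 := by simpa using zmod_two_eq_one hi
  have h := Equiv.sum_comp (Equiv.addRight (Pi.single i (1 : ZMod 2)))
    (fun s : Fin n → ZMod 2 => sg (s ⬝ᵥ z))
  simp only [Equiv.coe_addRight, add_dotProduct, sg_add, h1, sg_one, mul_neg, mul_one,
    Finset.sum_neg_distrib] at h
  linarith

lemma sum_sg_dotProduct_eq {n : ℕ} (z : Fin n → ZMod 2) :
    ∑ s : Fin n → ZMod 2, sg (s ⬝ᵥ z) = if z = 0 then 2 ^ n else 0 := by
  split_ifs with h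
  · simp [h, sg_zero]
  · exact sum_sg_dotProduct h

/-- Fourier coefficients of a real function on `F₂ⁿ`. -/
def hat {n : ℕ} (F : (Fin n → ZMod 2) → ℝ) (s : Fin n → ZMod 2) : ℝ :=
  (∑ x, F x * sg (s ⬝ᵥ x)) / 2 ^ n

/-- Fourier support of a real function on `F₂ⁿ`. -/
def hatSupport {n : ℕ} (F : (Fin n → ZMod 2) → ℝ) : Finset (Fin n → ZMod 2) :=
  Finset.univ.filter (fun s => hat F s ≠ 0)

lemma mem_hatSupport {n : ℕ} {F : (Fin n → ZMod 2) → ℝ} {s : Fin n → ZMod 2} :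
    s ∈ hatSupport F ↔ hat F s ≠ 0 := by simp [hatSupport]

lemma hat_inversion {n : ℕ} (F : (Fin n → ZMod 2) → ℝ) (x : Fin n → ZMod 2) :
    ∑ s, hat F s * sg (s ⬝ᵥ x) = F x := by
  have h : ∀ s, hat F s * sg (s ⬝ᵥ x) = (∑ y, F y * sg (s ⬝ᵥ (y + x))) / 2 ^ n := by
    intro s
    rw [hat, div_mul_eq_mul_div, Finset.sum_mul]
    simp only [dotProduct_add, sg_add, mul_assoc]
  simp only [h]
  rw [← Finset.sum_div, Finset.sum_comm]
  simp only [← Finset.mul_sum, sum_sg_dotProduct_eq]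
  rw [Finset.sum_eq_single x]
  · rw [add_self_vec]; simp
  · intro y _ hy
    have : y + x ≠ 0 := fun h => hy (by
      have := congrArg (· + x) h
      simpa [add_assoc, add_self_vec] using this)
    simp [this]
  · simp

lemma sum_hat_mul_hat_add {n : ℕ} {F : (Fin n → ZMod 2) → ℝ} (hF : ∀ x, F x = 1 ∨ F x = -1)
    (w : Fin n → ZMod 2) :
    ∑ s, hat F s * hat F (s + w) = if w = 0 then 1 else 0 := by
  have h : ∀ s, hat F s * hat F (s + w)
      = ∑ x, (F x * sg (w ⬝ᵥ x) / 2 ^ n) * (hat F s * sg (s ⬝ᵥ x)) := by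
    intro s
    conv_lhs => rw [hat.eq_def F (s + w)]
    rw [mul_comm, Finset.sum_div, Finset.sum_mul]
    refine Finset.sum_congr rfl fun x _ => ?_
    rw [add_dotProduct, sg_add]; ring
  simp only [h]
  rw [Finset.sum_comm]
  simp only [← Finset.mul_sum, hat_inversion]
  have h2 : ∀ x, F x * sg (w ⬝ᵥ x) / 2 ^ n * F x = sg (x ⬝ᵥ w) / 2 ^ n := by
    intro x
    rw [dotProduct_comm w x]
    rcases hF x with h | h <;> rw [h] <;> ring
  simp only [h2]
  rw [← Finset.sum_div, sum_sg_dotProduct_eq]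
  split_ifs <;> simp

lemma sum_sg_mul_hat_sq {n : ℕ} (F : (Fin n → ZMod 2) → ℝ) (T : Finset (Fin n → ZMod 2)) :
    ∑ a, (∑ s ∈ T, hat F s * sg (s ⬝ᵥ a)) ^ 2 = 2 ^ n * ∑ s ∈ T, hat F s ^ 2 := by
  have h : ∀ a, (∑ s ∈ T, hat F s * sg (s ⬝ᵥ a)) ^ 2
      = ∑ s ∈ T, ∑ t ∈ T, hat F s * hat F t * sg (a ⬝ᵥ (s + t)) := by
    intro a
    rw [sq, Finset.sum_mul_sum]
    refine Finset.sum_congr rfl fun s _ => Finset.sum_congr rfl fun t _ => ?_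
    rw [dotProduct_add, sg_add, dotProduct_comm a, dotProduct_comm a]; ring
  simp only [h]
  rw [Finset.sum_comm, Finset.mul_sum]
  refine Finset.sum_congr rfl fun s hs => ?_
  rw [Finset.sum_comm]
  simp only [← Finset.mul_sum, sum_sg_dotProduct_eq]
  rw [Finset.sum_eq_single s]
  · rw [add_self_vec]; simp; ring
  · intro t _ ht
    have : s + t ≠ 0 := fun h => ht (by
      have := congrArg (s + ·) h
      simpa [← add_assoc, add_self_vec] using this)
    simp [this]
  · intro h; exact absurd hs h

lemma hat_eq_of_sign {n : ℕ} {F : (Fin n → ZMod 2) → ℝ} (hF : ∀ x, F x = 1 ∨ F x = -1)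
    (s : Fin n → ZMod 2) :
    hat F s = (if s = 0 then 1 else 0)
      - 2 * (∑ x with F x = -1, sg (s ⬝ᵥ x)) / 2 ^ n := by
  have h : ∀ x, F x * sg (s ⬝ᵥ x)
      = sg (x ⬝ᵥ s) - 2 * (if F x = -1 then sg (s ⬝ᵥ x) else 0) := by
    intro x
    rw [dotProduct_comm x s]
    rcases hF x with h | h <;> rw [h] <;> norm_num
    ring
  rw [hat]
  simp only [h]
  rw [Finset.sum_sub_distrib, sum_sg_dotProduct_eq, ← Finset.mul_sum, Finset.sum_filter, sub_div]
  congr 1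
  split_ifs <;> simp

/-- The part of the Fourier expansion of `F` with frequencies in the coset `q` of `W`. -/
def cosetPart {n : ℕ} (F : (Fin n → ZMod 2) → ℝ) (W : Submodule (ZMod 2) (Fin n → ZMod 2))
    (q : (Fin n → ZMod 2) ⧸ W) (a : Fin n → ZMod 2) : ℝ :=
  ∑ s with W.mkQ s = q, hat F s * sg (s ⬝ᵥ a)

/-- The nonzero cosets of `W` that meet the Fourier support. -/
def cosetSupport {n : ℕ} (F : (Fin n → ZMod 2) → ℝ) (W : Submodule (ZMod 2) (Fin n → ZMod 2)) :
    Finset ((Fin n → ZMod 2) ⧸ W) :=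
  Finset.univ.filter (fun q => q ≠ 0 ∧ ∃ s ∈ hatSupport F, W.mkQ s = q)

/-- The nonzero cosets of `W` whose part of the Fourier expansion does not vanish at `a`. -/
def localSupport {n : ℕ} (F : (Fin n → ZMod 2) → ℝ) (W : Submodule (ZMod 2) (Fin n → ZMod 2))
    (a : Fin n → ZMod 2) : Finset ((Fin n → ZMod 2) ⧸ W) :=
  Finset.univ.filter (fun q => q ≠ 0 ∧ cosetPart F W q a ≠ 0)

lemma mem_cosetSupport {n : ℕ} {F : (Fin n → ZMod 2) → ℝ}
    {W : Submodule (ZMod 2) (Fin n → ZMod 2)} {q : (Fin n → ZMod 2) ⧸ W} :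
    q ∈ cosetSupport F W ↔ q ≠ 0 ∧ ∃ s ∈ hatSupport F, W.mkQ s = q := by
  rw [cosetSupport, Finset.mem_filter]
  simp only [Finset.mem_univ, true_and]

lemma mem_localSupport {n : ℕ} {F : (Fin n → ZMod 2) → ℝ}
    {W : Submodule (ZMod 2) (Fin n → ZMod 2)} {q : (Fin n → ZMod 2) ⧸ W} {a : Fin n → ZMod 2} :
    q ∈ localSupport F W a ↔ q ≠ 0 ∧ cosetPart F W q a ≠ 0 := by
  simp [localSupport]

lemma localSupport_subset {n : ℕ} (F : (Fin n → ZMod 2) → ℝ)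
    (W : Submodule (ZMod 2) (Fin n → ZMod 2)) (a : Fin n → ZMod 2) :
    localSupport F W a ⊆ cosetSupport F W := by
  intro q hq
  obtain ⟨h0, h⟩ := mem_localSupport.1 hq
  obtain ⟨s, hs, hne⟩ := Finset.exists_ne_zero_of_sum_ne_zero h
  exact mem_cosetSupport.2 ⟨h0, s, mem_hatSupport.2 (left_ne_zero_of_mul hne),
    (Finset.mem_filter.1 hs).2⟩

lemma sum_cosetPart_sq {n : ℕ} {F : (Fin n → ZMod 2) → ℝ} (hF : ∀ x, F x = 1 ∨ F x = -1)
    (W : Submodule (ZMod 2) (Fin n → ZMod 2)) (a : Fin n → ZMod 2) :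
    ∑ q, cosetPart F W q a ^ 2 = 1 := by
  have h1 : ∀ q, cosetPart F W q a ^ 2
      = ∑ s with W.mkQ s = q, hat F s * sg (s ⬝ᵥ a) * cosetPart F W (W.mkQ s) a := by
    intro q
    conv_lhs => rw [sq]
    conv_lhs => enter [1]; rw [cosetPart]
    rw [Finset.sum_mul]
    refine Finset.sum_congr rfl fun s hs => ?_
    rw [(Finset.mem_filter.1 hs).2]
  simp only [h1]
  rw [Finset.sum_fiberwise Finset.univ (fun s => W.mkQ s)
    (fun s => hat F s * sg (s ⬝ᵥ a) * cosetPart F W (W.mkQ s) a)]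
  have h2 : ∀ s, hat F s * sg (s ⬝ᵥ a) * cosetPart F W (W.mkQ s) a
      = ∑ w, (if w ∈ W then sg (w ⬝ᵥ a) else 0) * (hat F s * hat F (s + w)) := by
    intro s
    rw [cosetPart, Finset.sum_filter, ← Equiv.sum_comp (Equiv.addLeft s), Finset.mul_sum]
    refine Finset.sum_congr rfl fun w _ => ?_
    have : W.mkQ (s + w) = W.mkQ s ↔ w ∈ W := by simp
    simp only [Equiv.coe_addLeft, this]
    split_ifs
    · rw [add_dotProduct, sg_add]
      linear_combination (hat F s * hat F (s + w) * sg (w ⬝ᵥ a)) * sg_mul_self (s ⬝ᵥ a)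
    · simp
  simp only [h2]
  rw [Finset.sum_comm]
  simp only [← Finset.mul_sum, sum_hat_mul_hat_add hF]
  simp [sg_zero]

lemma abs_cosetPart_le_one {n : ℕ} {F : (Fin n → ZMod 2) → ℝ} (hF : ∀ x, F x = 1 ∨ F x = -1)
    (W : Submodule (ZMod 2) (Fin n → ZMod 2)) (q : (Fin n → ZMod 2) ⧸ W) (a : Fin n → ZMod 2) :
    |cosetPart F W q a| ≤ 1 := by
  rw [← sq_le_one_iff_abs_le_one, ← sum_cosetPart_sq hF W a]
  exact Finset.single_le_sum (f := fun q => cosetPart F W q a ^ 2)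
    (fun _ _ => sq_nonneg _) (Finset.mem_univ q)

lemma sum_localSupport_sq {n : ℕ} {F : (Fin n → ZMod 2) → ℝ} (hF : ∀ x, F x = 1 ∨ F x = -1)
    (W : Submodule (ZMod 2) (Fin n → ZMod 2)) (a : Fin n → ZMod 2) :
    ∑ q ∈ localSupport F W a, cosetPart F W q a ^ 2 = 1 - cosetPart F W 0 a ^ 2 := by
  rw [eq_sub_iff_add_eq', ← sum_cosetPart_sq hF W a,
    ← Finset.add_sum_erase Finset.univ _ (Finset.mem_univ 0)]
  congr 1
  refine Finset.sum_subset (fun q hq => ?_) (fun q hq hq' => ?_)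
  · exact Finset.mem_erase.2 ⟨(mem_localSupport.1 hq).1, Finset.mem_univ _⟩
  · have h : ¬ (q ≠ 0 ∧ cosetPart F W q a ≠ 0) := fun h => hq' (mem_localSupport.2 h)
    have h0 := (Finset.mem_erase.1 hq).1
    have : cosetPart F W q a = 0 := by tauto
    simp [this]

lemma cosetPart_eq_zero_of_const {n : ℕ} {F : (Fin n → ZMod 2) → ℝ}
    (hF : ∀ x, F x = 1 ∨ F x = -1) {W : Submodule (ZMod 2) (Fin n → ZMod 2)}
    {a : Fin n → ZMod 2} (h : |cosetPart F W 0 a| = 1) {q : (Fin n → ZMod 2) ⧸ W} (hq : q ≠ 0) :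
    cosetPart F W q a = 0 := by
  by_contra hne
  have h1 := sum_localSupport_sq hF W a
  rw [← sq_abs (cosetPart F W 0 a), h] at h1
  have h2 := (Finset.sum_eq_zero_iff_of_nonneg (fun _ _ => sq_nonneg _)).1
    (h1.trans (by norm_num)) q (mem_localSupport.2 ⟨hq, hne⟩)
  exact hne (by simpa using h2)

lemma cosetPart_factor {n : ℕ} (F : (Fin n → ZMod 2) → ℝ)
    {W W' : Submodule (ZMod 2) (Fin n → ZMod 2)} (h : W ≤ W') (q : (Fin n → ZMod 2) ⧸ W')
    (a : Fin n → ZMod 2) :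
    cosetPart F W' q a = ∑ p with Submodule.factor h p = q, cosetPart F W p a := by
  simp only [cosetPart]
  rw [Finset.sum_filter (s := Finset.univ) (p := fun p => Submodule.factor h p = q)]
  have : ∀ p, (if Submodule.factor h p = q then
        ∑ s with W.mkQ s = p, hat F s * sg (s ⬝ᵥ a) else 0)
      = ∑ s with W.mkQ s = p, if W'.mkQ s = q then hat F s * sg (s ⬝ᵥ a) else 0 := by
    intro p
    rw [← Finset.sum_filter, Finset.filter_filter]
    split_ifs with hp
    · refine Finset.sum_congr (Finset.filter_congr fun s _ => ?_) fun _ _ => rfl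
      constructor
      · rintro rfl; exact ⟨rfl, by simpa using hp⟩
      · exact fun h => h.1
    · rw [Finset.filter_eq_empty_iff.2, Finset.sum_empty]
      rintro s _ ⟨rfl, hs⟩
      exact hp (by simpa using hs)
  simp only [this]
  rw [Finset.sum_fiberwise Finset.univ (fun s => W.mkQ s)
    (fun s => if W'.mkQ s = q then hat F s * sg (s ⬝ᵥ a) else 0), Finset.sum_filter]

lemma cosetPart_translate {n : ℕ} (F : (Fin n → ZMod 2) → ℝ)
    {W : Submodule (ZMod 2) (Fin n → ZMod 2)} {a b : Fin n → ZMod 2}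
    (hab : ∀ w ∈ W, w ⬝ᵥ b = w ⬝ᵥ a) (t : Fin n → ZMod 2) :
    cosetPart F W (W.mkQ t) b = sg (t ⬝ᵥ (b - a)) * cosetPart F W (W.mkQ t) a := by
  rw [cosetPart, cosetPart, Finset.mul_sum]
  refine Finset.sum_congr rfl fun s hs => ?_
  have hs' : s - t ∈ W := by
    rw [← Submodule.Quotient.eq]; exact (Finset.mem_filter.1 hs).2
  have h1 : s ⬝ᵥ b = t ⬝ᵥ (b - a) + s ⬝ᵥ a := by
    have := hab _ hs'
    simp only [sub_dotProduct, dotProduct_sub] at this ⊢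
    linear_combination this
  rw [h1, sg_add]; ring

lemma localSupport_translate {n : ℕ} (F : (Fin n → ZMod 2) → ℝ)
    {W : Submodule (ZMod 2) (Fin n → ZMod 2)} {a b : Fin n → ZMod 2}
    (hab : ∀ w ∈ W, w ⬝ᵥ b = w ⬝ᵥ a) :
    localSupport F W b = localSupport F W a := by
  ext q
  obtain ⟨t, rfl⟩ := W.mkQ_surjective q
  have : sg (t ⬝ᵥ (b - a)) ≠ 0 := by
    rcases sg_eq (t ⬝ᵥ (b - a)) with h | h <;> rw [h] <;> norm_num
  rw [mem_localSupport, mem_localSupport, cosetPart_translate F hab]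
  simp only [ne_eq, mul_eq_zero, this, false_or]

lemma card_localSupport_le {n : ℕ} (F : (Fin n → ZMod 2) → ℝ)
    {W W' : Submodule (ZMod 2) (Fin n → ZMod 2)} (h : W ≤ W') (a : Fin n → ZMod 2) :
    (localSupport F W' a).card ≤ (localSupport F W a).card := by
  refine (Finset.card_le_card ?_).trans (Finset.card_image_le (f := Submodule.factor h))
  intro q hq
  obtain ⟨h0, hne⟩ := mem_localSupport.1 hq
  rw [cosetPart_factor F h] at hne
  obtain ⟨p, hp, hpne⟩ := Finset.exists_ne_zero_of_sum_ne_zero hne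
  have hp' := (Finset.mem_filter.1 hp).2
  refine Finset.mem_image.2 ⟨p, mem_localSupport.2 ⟨?_, hpne⟩, hp'⟩
  rintro rfl
  exact h0 (by rw [← hp', map_zero])

/-- If `F` is constant on a coset of `W'ᗮ`, passing from `W` to `W'` merges the locally
supported cosets of `W`. -/
lemma two_mul_card_cosetSupport_add_le {n : ℕ} {F : (Fin n → ZMod 2) → ℝ}
    (hF : ∀ x, F x = 1 ∨ F x = -1) {W W' : Submodule (ZMod 2) (Fin n → ZMod 2)} (h : W ≤ W')
    {a : Fin n → ZMod 2} (ha : |cosetPart F W' 0 a| = 1) :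
    2 * (cosetSupport F W').card + (localSupport F W a).card ≤ 2 * (cosetSupport F W).card := by
  set π := Submodule.factor h
  set K := cosetSupport F W
  set N := localSupport F W a
  have hNK : N ⊆ K := localSupport_subset F W a
  have hK := Finset.card_filter_add_card_filter_not (s := K) (fun q => π q = 0)
  have hN := Finset.card_filter_add_card_filter_not (s := N) (fun q => π q = 0)
  have h0 : (N.filter (fun q => π q = 0)).card ≤ (K.filter (fun q => π q = 0)).card :=
    Finset.card_le_card (Finset.filter_subset_filter _ hNK)
  have hmapK : Set.MapsTo π (K.filter (fun q => ¬ π q = 0)) (cosetSupport F W') := by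
    intro q hq
    obtain ⟨hq, hq0⟩ := Finset.mem_filter.1 hq
    obtain ⟨_, s, hs, rfl⟩ := mem_cosetSupport.1 hq
    exact mem_cosetSupport.2 ⟨hq0, s, hs, by simp [π]⟩
  have hmapN : Set.MapsTo π (N.filter (fun q => ¬ π q = 0)) (cosetSupport F W') :=
    fun q hq => hmapK (Finset.filter_subset_filter _ hNK hq)
  have h1 := Finset.card_eq_sum_card_fiberwise hmapK
  have h2 := Finset.card_eq_sum_card_fiberwise hmapN
  have key : ∑ q ∈ cosetSupport F W',
      (2 + ((N.filter (fun q => ¬ π q = 0)).filter (fun p => π p = q)).card)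
      ≤ ∑ q ∈ cosetSupport F W',
        2 * ((K.filter (fun q => ¬ π q = 0)).filter (fun p => π p = q)).card := by
    refine Finset.sum_le_sum fun q hq => ?_
    obtain ⟨hq0, s, hs, hsq⟩ := mem_cosetSupport.1 hq
    set A := (N.filter (fun q => ¬ π q = 0)).filter (fun p => π p = q) with hA
    set B := (K.filter (fun q => ¬ π q = 0)).filter (fun p => π p = q) with hB
    have hAB : A ⊆ B := Finset.filter_subset_filter _ (Finset.filter_subset_filter _ hNK)
    have hcard := Finset.card_le_card hAB
    have memB : ∀ p, p ∈ B ↔ p ∈ K ∧ π p = q := by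
      intro p
      simp only [hB, Finset.mem_filter, and_assoc]
      refine and_congr_right fun _ => ⟨fun h => h.2, fun h => ⟨by rwa [h], h⟩⟩
    have hBpos : 0 < B.card := by
      refine Finset.card_pos.2 ⟨W.mkQ s, (memB _).2 ⟨mem_cosetSupport.2 ⟨?_, s, hs, rfl⟩, ?_⟩⟩
      · intro h0
        apply hq0
        rw [← hsq]
        have : π (W.mkQ s) = 0 := by rw [h0, map_zero]
        simpa [π] using this
      · rw [← hsq]; simp [π]
    rcases A.eq_empty_or_nonempty with hAe | ⟨p, hp⟩
    · rw [hAe, Finset.card_empty]; omega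
    · have hpB := hAB hp
      have hpN : p ∈ N := (Finset.mem_filter.1 (Finset.mem_filter.1 hp).1).1
      have hpq : π p = q := ((memB p).1 hpB).2
      have hsum := cosetPart_eq_zero_of_const hF ha hq0
      rw [cosetPart_factor F h] at hsum
      have : ∃ p' ∈ Finset.univ.filter (fun p => π p = q), p' ≠ p ∧ cosetPart F W p' a ≠ 0 := by
        by_contra hcon
        push Not at hcon
        rw [Finset.sum_eq_single p hcon (fun hp => absurd (by simp [hpq]) hp)] at hsum
        exact (mem_localSupport.1 hpN).2 hsum
      obtain ⟨p', hp'q, hne, hp'⟩ := this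
      have hp'q := (Finset.mem_filter.1 hp'q).2
      have hp'B : p' ∈ B := by
        refine (memB _).2 ⟨hNK (mem_localSupport.2 ⟨?_, hp'⟩), hp'q⟩
        rintro rfl
        exact hq0 (by rw [← hp'q, map_zero])
      have : 1 < B.card := Finset.one_lt_card.2 ⟨p', hp'B, p, hpB, hne⟩
      omega
  rw [Finset.sum_add_distrib, ← Finset.mul_sum, ← h1, ← h2, Finset.sum_const, smul_eq_mul] at key
  omega

lemma exists_dotProduct_eq_one {n : ℕ} {W : Submodule (ZMod 2) (Fin n → ZMod 2)}
    {v : Fin n → ZMod 2} (hv : v ∉ W) :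
    ∃ x : Fin n → ZMod 2, (∀ w ∈ W, w ⬝ᵥ x = 0) ∧ v ⬝ᵥ x = 1 := by
  obtain ⟨φ, hφv, hφW⟩ := Submodule.exists_le_ker_of_notMem hv
  obtain ⟨x, rfl⟩ := (dotProductEquiv (ZMod 2) (Fin n)).surjective φ
  refine ⟨x, fun w hw => ?_, zmod_two_eq_one ?_⟩
  · have := hφW hw
    rw [dotProduct_comm]
    simpa using this
  · rw [dotProduct_comm]
    simpa using hφv

lemma factor_sup_span_eq_zero {n : ℕ} {W : Submodule (ZMod 2) (Fin n → ZMod 2)}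
    (v : Fin n → ZMod 2) (h : W ≤ W ⊔ Submodule.span (ZMod 2) {v})
    (p : (Fin n → ZMod 2) ⧸ W) :
    Submodule.factor h p = 0 ↔ p = 0 ∨ p = W.mkQ v := by
  obtain ⟨t, rfl⟩ := W.mkQ_surjective p
  have h1 : Submodule.factor h (W.mkQ t) = 0 ↔ t ∈ W ⊔ Submodule.span (ZMod 2) {v} := by simp
  rw [h1, Submodule.mem_sup]
  constructor
  · rintro ⟨w, hw, z, hz, rfl⟩
    obtain ⟨c, rfl⟩ := Submodule.mem_span_singleton.1 hz
    by_cases hc : c = 0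
    · left; simpa [hc] using hw
    · right; simpa [zmod_two_eq_one hc] using hw
  · rintro (h | h)
    · exact ⟨t, by simpa using h, 0, Submodule.zero_mem _, add_zero t⟩
    · exact ⟨t - v, (Submodule.Quotient.eq W).1 h, v, Submodule.mem_span_singleton_self v,
        sub_add_cancel t v⟩

lemma exists_abs_cosetPart_add {n : ℕ} {F : (Fin n → ZMod 2) → ℝ}
    (hF : ∀ x, F x = 1 ∨ F x = -1) (W : Submodule (ZMod 2) (Fin n → ZMod 2))
    (a : Fin n → ZMod 2) (hN : (localSupport F W a).Nonempty) :
    ∃ (W' : Submodule (ZMod 2) (Fin n → ZMod 2)) (b : Fin n → ZMod 2) (M : ℝ), W ≤ W' ∧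
      (∀ w ∈ W, w ⬝ᵥ b = w ⬝ᵥ a) ∧
      Module.finrank (ZMod 2) W' ≤ Module.finrank (ZMod 2) W + 1 ∧ 0 < M ∧
      1 - |cosetPart F W 0 a| ≤ M ^ 2 * (localSupport F W a).card ∧
      |cosetPart F W' 0 b| = |cosetPart F W 0 a| + M := by
  obtain ⟨q, hq, hmax⟩ := Finset.exists_max_image _ (fun q => |cosetPart F W q a|) hN
  obtain ⟨hq0, hqne⟩ := mem_localSupport.1 hq
  obtain ⟨v, rfl⟩ := W.mkQ_surjective q
  have hv : v ∉ W := fun h => hq0 (by simpa using h)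
  obtain ⟨h, hhW, hhv⟩ := exists_dotProduct_eq_one hv
  have hle : W ≤ W ⊔ Submodule.span (ZMod 2) {v} := le_sup_left
  have hfin : Module.finrank (ZMod 2) ↥(W ⊔ Submodule.span (ZMod 2) {v})
      ≤ Module.finrank (ZMod 2) W + 1 := by
    refine (Submodule.finrank_add_le_finrank_add_finrank _ _).trans (Nat.add_le_add_left ?_ _)
    exact (finrank_span_le_card _).trans (by simp)
  have hsq : 1 - |cosetPart F W 0 a|
      ≤ |cosetPart F W (W.mkQ v) a| ^ 2 * (localSupport F W a).card := by
    have h1 := sum_localSupport_sq hF W a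
    have h2 : ∑ q ∈ localSupport F W a, cosetPart F W q a ^ 2
        ≤ ∑ q ∈ localSupport F W a, |cosetPart F W (W.mkQ v) a| ^ 2 :=
      Finset.sum_le_sum fun q hq => by
        rw [← sq_abs (cosetPart F W q a)]
        exact pow_le_pow_left₀ (abs_nonneg _) (hmax q hq) 2
    rw [h1, Finset.sum_const, nsmul_eq_mul, ← sq_abs (cosetPart F W 0 a)] at h2
    nlinarith [abs_nonneg (cosetPart F W 0 a), abs_cosetPart_le_one hF W 0 a]
  have hsum : ∀ b, cosetPart F (W ⊔ Submodule.span (ZMod 2) {v}) 0 b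
      = cosetPart F W 0 b + cosetPart F W (W.mkQ v) b := by
    intro b
    rw [cosetPart_factor F hle]
    have : Finset.univ.filter (fun p => Submodule.factor hle p = 0) = {0, W.mkQ v} := by
      ext p
      rw [Finset.mem_filter, factor_sup_span_eq_zero]
      simp
    rw [this, Finset.sum_pair (Ne.symm hq0)]
  have htrans : ∀ w ∈ W, w ⬝ᵥ (a + h) = w ⬝ᵥ a := fun w hw => by
    rw [dotProduct_add, hhW w hw, add_zero]
  have hP0 : cosetPart F W 0 (a + h) = cosetPart F W 0 a := by
    have := cosetPart_translate F htrans 0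
    simpa [sg_zero] using this
  have hPv : cosetPart F W (W.mkQ v) (a + h) = -cosetPart F W (W.mkQ v) a := by
    rw [cosetPart_translate F htrans v, add_sub_cancel_left, hhv, sg_one, neg_one_mul]
  by_cases hsgn : 0 ≤ cosetPart F W 0 a * cosetPart F W (W.mkQ v) a
  · refine ⟨_, a, _, hle, fun _ _ => rfl, hfin, abs_pos.2 hqne, hsq, ?_⟩
    rw [hsum, abs_add_eq_add_abs_iff]
    rcases mul_nonneg_iff.1 hsgn with h | h
    · exact Or.inl h
    · exact Or.inr h
  · refine ⟨_, a + h, _, hle, htrans, hfin, abs_pos.2 hqne, hsq, ?_⟩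
    rw [hsum, hP0, hPv, ← abs_neg (cosetPart F W (W.mkQ v) a), abs_add_eq_add_abs_iff]
    rcases mul_nonneg_iff.1 (le_of_lt (by linarith : 0 < cosetPart F W 0 a *
      -cosetPart F W (W.mkQ v) a)) with h | h
    · exact Or.inl h
    · exact Or.inr h

lemma exists_const_of_sq_bound {n : ℕ} {F : (Fin n → ZMod 2) → ℝ}
    (hF : ∀ x, F x = 1 ∨ F x = -1) (m : ℕ) :
    ∀ (W : Submodule (ZMod 2) (Fin n → ZMod 2)) (a : Fin n → ZMod 2),
      4 * ((1 - |cosetPart F W 0 a|) * (localSupport F W a).card) ≤ (m : ℝ) ^ 2 →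
      ∃ (W' : Submodule (ZMod 2) (Fin n → ZMod 2)) (b : Fin n → ZMod 2), W ≤ W' ∧
        (∀ w ∈ W, w ⬝ᵥ b = w ⬝ᵥ a) ∧
        Module.finrank (ZMod 2) W' ≤ Module.finrank (ZMod 2) W + m ∧
        |cosetPart F W' 0 b| = 1 := by
  have base : ∀ (W : Submodule (ZMod 2) (Fin n → ZMod 2)) (a : Fin n → ZMod 2),
      ¬ (localSupport F W a).Nonempty → |cosetPart F W 0 a| = 1 := by
    intro W a hN
    have h := sum_localSupport_sq hF W a
    rw [Finset.not_nonempty_iff_eq_empty.1 hN, Finset.sum_empty] at h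
    exact (pow_eq_one_iff_of_nonneg (abs_nonneg _) two_ne_zero).1 (by rw [sq_abs]; linarith)
  induction m with
  | zero =>
    intro W a hm
    by_cases hN : (localSupport F W a).Nonempty
    · obtain ⟨W', b, M, -, -, -, hM, -, hb⟩ := exists_abs_cosetPart_add hF W a hN
      have h1 := abs_cosetPart_le_one hF W' 0 b
      have h2 : (0 : ℝ) < (localSupport F W a).card := by exact_mod_cast hN.card_pos
      have h3 : 0 < (1 - |cosetPart F W 0 a|) * (localSupport F W a).card :=
        mul_pos (by linarith) h2
      norm_num at hm
      linarith
    · exact ⟨W, a, le_rfl, fun _ _ => rfl, by simp, base W a hN⟩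
  | succ m ih =>
    intro W a hm
    by_cases hN : (localSupport F W a).Nonempty
    · obtain ⟨W₁, b, M, hle, hb, hfin, hM, hy, hP⟩ := exists_abs_cosetPart_add hF W a hN
      have hs' : ((localSupport F W₁ b).card : ℝ) ≤ (localSupport F W a).card := by
        rw [← localSupport_translate F hb]
        exact_mod_cast card_localSupport_le F hle b
      have h1 := abs_cosetPart_le_one hF W₁ 0 b
      obtain ⟨W', c, hle', hc, hfin', hP'⟩ := ih W₁ b (by
        have hy1 : 0 ≤ 1 - |cosetPart F W₁ 0 b| := by linarith
        have h2 := mul_le_mul_of_nonneg_left hs' hy1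
        set s : ℝ := ((localSupport F W a).card : ℝ)
        have hs : 0 ≤ s := Nat.cast_nonneg _
        rw [hP] at h2 ⊢
        push_cast at hm
        have hv : (1 - |cosetPart F W 0 a|) * s ≤ (M * s) ^ 2 := by nlinarith
        have hu : 0 ≤ M * s := by positivity
        have hm0 : (0 : ℝ) ≤ m := Nat.cast_nonneg _
        refine (mul_le_mul_of_nonneg_left h2 (by norm_num)).trans ?_
        rcases le_total ((m + 1 : ℝ) / 2) (M * s) with h | h
        · nlinarith
        · nlinarith [mul_nonneg hu hm0, mul_nonneg hu (sub_nonneg.2 h)])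
      exact ⟨W', c, hle.trans hle', fun w hw => (hc w (hle hw)).trans (hb w hw), by omega, hP'⟩
    · exact ⟨W, a, le_rfl, fun _ _ => rfl, by omega, base W a hN⟩

/-- Some coset of a subspace of dimension `O(√(δ s))` larger makes `F` constant. -/
lemma exists_const_of_localSupport {n : ℕ} {F : (Fin n → ZMod 2) → ℝ}
    (hF : ∀ x, F x = 1 ∨ F x = -1) (W : Submodule (ZMod 2) (Fin n → ZMod 2))
    (a : Fin n → ZMod 2) (hN : (localSupport F W a).Nonempty) :
    ∃ (W' : Submodule (ZMod 2) (Fin n → ZMod 2)) (b : Fin n → ZMod 2), W ≤ W' ∧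
      (∀ w ∈ W, w ⬝ᵥ b = w ⬝ᵥ a) ∧
      (Module.finrank (ZMod 2) W' : ℝ) ≤ Module.finrank (ZMod 2) W
        + 3 * √((1 - |cosetPart F W 0 a|) * (localSupport F W a).card) ∧
      |cosetPart F W' 0 b| = 1 := by
  have hone : 1 ≤ (1 - |cosetPart F W 0 a|) * (localSupport F W a).card := by
    obtain ⟨W', b, M, -, -, -, hM, hy, hb⟩ := exists_abs_cosetPart_add hF W a hN
    have h1 := abs_cosetPart_le_one hF W' 0 b
    have h2 : (0 : ℝ) < (localSupport F W a).card := by exact_mod_cast hN.card_pos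
    set y := 1 - |cosetPart F W 0 a|
    have hy0 : 0 < y := by linarith
    have hMy : M ^ 2 ≤ y ^ 2 := pow_le_pow_left₀ hM.le (by linarith) 2
    nlinarith
  set z := (1 - |cosetPart F W 0 a|) * (localSupport F W a).card
  have hz : 1 ≤ √z := Real.one_le_sqrt.2 hone
  have hzz : √z ^ 2 = z := Real.sq_sqrt (by linarith)
  obtain ⟨W', b, hle, hb, hfin, hP⟩ := exists_const_of_sq_bound hF ⌈2 * √z⌉₊ W a (by
    have := Nat.le_ceil (2 * √z)
    have := pow_le_pow_left₀ (by positivity) this 2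
    change 4 * z ≤ _
    nlinarith)
  refine ⟨W', b, hle, hb, ?_, hP⟩
  have h1 : (Module.finrank (ZMod 2) W' : ℝ) ≤ Module.finrank (ZMod 2) W + ⌈2 * √z⌉₊ := by
    exact_mod_cast hfin
  have h2 := Nat.ceil_lt_add_one (by positivity : 0 ≤ 2 * √z)
  linarith

lemma two_pow_le_card_fiber_mul {n : ℕ} (F : (Fin n → ZMod 2) → ℝ)
    (W : Submodule (ZMod 2) (Fin n → ZMod 2)) {q : (Fin n → ZMod 2) ⧸ W}
    (hq : q ∈ cosetSupport F W) :
    (2 : ℝ) ^ n ≤ ((hatSupport F).filter (fun s => W.mkQ s = q)).card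
      * ((Finset.univ.filter (fun a => cosetPart F W q a ≠ 0)).card : ℝ) := by
  obtain ⟨_, s, hs, hsq⟩ := mem_cosetSupport.1 hq
  set T := (hatSupport F).filter (fun s => W.mkQ s = q)
  have hP : ∀ a, cosetPart F W q a = ∑ s ∈ T, hat F s * sg (s ⬝ᵥ a) := by
    intro a
    rw [cosetPart]
    refine (Finset.sum_subset (Finset.filter_subset_filter _ (Finset.subset_univ _)) ?_).symm
    intro t ht ht'
    have : hat F t = 0 := by
      by_contra hne
      exact ht' (Finset.mem_filter.2 ⟨mem_hatSupport.2 hne, (Finset.mem_filter.1 ht).2⟩)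
    simp [this]
  set E := ∑ s ∈ T, hat F s ^ 2
  have hE : 0 < E := by
    refine Finset.sum_pos' (fun _ _ => sq_nonneg _) ⟨s, Finset.mem_filter.2 ⟨hs, hsq⟩, ?_⟩
    have := mem_hatSupport.1 hs
    positivity
  have h1 : ∑ a, cosetPart F W q a ^ 2 = 2 ^ n * E := by
    simp only [hP]; exact sum_sg_mul_hat_sq F T
  have h2 : ∀ a, cosetPart F W q a ^ 2 ≤ T.card * E := by
    intro a
    rw [hP]
    refine (sq_sum_le_card_mul_sum_sq).trans (le_of_eq ?_)
    congr 1
    refine Finset.sum_congr rfl fun s _ => ?_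
    rw [mul_pow, sq (sg _), sg_mul_self, mul_one]
  have h3 : ∑ a, cosetPart F W q a ^ 2
      ≤ (Finset.univ.filter (fun a => cosetPart F W q a ≠ 0)).card * (T.card * E) := by
    rw [← nsmul_eq_mul, ← Finset.sum_const, Finset.sum_filter]
    refine Finset.sum_le_sum fun a _ => ?_
    split_ifs with h
    · exact h2 a
    · rw [not_not.1 h]; simp
  rw [h1] at h3
  exact le_of_mul_le_mul_right (h3.trans_eq (by ring)) hE

lemma two_pow_mul_card_sq_le {n : ℕ} (F : (Fin n → ZMod 2) → ℝ)
    (W : Submodule (ZMod 2) (Fin n → ZMod 2)) :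
    (2 : ℝ) ^ n * (cosetSupport F W).card ^ 2
      ≤ (hatSupport F).card * ∑ a, ((localSupport F W a).card : ℝ) := by
  set e := fun q => ((Finset.univ.filter (fun a => cosetPart F W q a ≠ 0)).card : ℝ)
  set κ := fun q => (((hatSupport F).filter (fun s => W.mkQ s = q)).card : ℝ)
  have hsum : ∑ a, ((localSupport F W a).card : ℝ) = ∑ q ∈ cosetSupport F W, e q := by
    have h1 : ∀ a, ((localSupport F W a).card : ℝ)
        = ∑ q ∈ cosetSupport F W, if cosetPart F W q a ≠ 0 then 1 else 0 := by
      intro a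
      rw [Finset.sum_boole]
      congr 2
      ext q
      rw [Finset.mem_filter]
      exact ⟨fun h => ⟨localSupport_subset F W a h, (mem_localSupport.1 h).2⟩,
        fun h => mem_localSupport.2 ⟨(mem_cosetSupport.1 h.1).1, h.2⟩⟩
    simp only [h1]
    rw [Finset.sum_comm]
    refine Finset.sum_congr rfl fun q _ => ?_
    rw [Finset.sum_boole]
  have hκ : ∑ q ∈ cosetSupport F W, κ q ≤ (hatSupport F).card := by
    have h := Finset.card_eq_sum_card_fiberwise (s := hatSupport F) (t := Finset.univ)
      (f := fun s => W.mkQ s) (fun _ _ => Finset.mem_coe.2 (Finset.mem_univ _))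
    rw [h]
    push_cast
    exact Finset.sum_le_sum_of_subset_of_nonneg (Finset.subset_univ _)
      fun _ _ _ => Nat.cast_nonneg _
  have hcs := Finset.sum_sq_le_sum_mul_sum_of_sq_le_mul (cosetSupport F W)
    (r := fun _ => √((2 : ℝ) ^ n)) (f := κ) (g := e) (fun _ _ => Nat.cast_nonneg _)
    (fun _ _ => Nat.cast_nonneg _) (fun q hq => by
      rw [Real.sq_sqrt (by positivity)]
      exact two_pow_le_card_fiber_mul F W hq)
  rw [Finset.sum_const, nsmul_eq_mul, mul_pow, Real.sq_sqrt (by positivity)] at hcs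
  rw [hsum, mul_comm]
  exact hcs.trans (mul_le_mul_of_nonneg_right hκ
    (Finset.sum_nonneg fun _ _ => Nat.cast_nonneg _))

lemma sum_cosetPart_zero {n : ℕ} (F : (Fin n → ZMod 2) → ℝ)
    (W : Submodule (ZMod 2) (Fin n → ZMod 2)) :
    ∑ a, cosetPart F W 0 a = 2 ^ n * hat F 0 := by
  simp only [cosetPart]
  rw [Finset.sum_comm]
  simp only [← Finset.mul_sum]
  have : ∀ s : Fin n → ZMod 2, ∑ a : Fin n → ZMod 2, sg (s ⬝ᵥ a) = if s = 0 then 2 ^ n else 0 := by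
    intro s
    simp only [dotProduct_comm s, sum_sg_dotProduct_eq]
  simp only [this]
  rw [Finset.sum_eq_single 0]
  · simp [mul_comm]
  · intro s _ hs; simp [hs]
  · intro h; simp at h

/-- Some point `a` has a locally supported set that is large relative to the bias at `a`. -/
lemma exists_localSupport_large {n : ℕ} {F : (Fin n → ZMod 2) → ℝ}
    (W : Submodule (ZMod 2) (Fin n → ZMod 2)) (hK : (cosetSupport F W).Nonempty)
    (hδ : hat F 0 ≤ 1) (hle : ∀ a, |cosetPart F W 0 a| ≤ 1) :
    ∃ a, (localSupport F W a).Nonempty ∧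
      (1 - |cosetPart F W 0 a|) * (cosetSupport F W).card ^ 2
        ≤ (localSupport F W a).card * ((1 - hat F 0) * (hatSupport F).card) := by
  have hsum := two_pow_mul_card_sq_le F W
  have hKpos : (0 : ℝ) < (cosetSupport F W).card := by exact_mod_cast hK.card_pos
  by_contra! hcon
  have hex : ∃ a, (localSupport F W a).Nonempty := by
    by_contra! hemp
    simp only [hemp, Finset.card_empty, Nat.cast_zero, Finset.sum_const_zero, mul_zero] at hsum
    have : (0 : ℝ) < 2 ^ n * (cosetSupport F W).card ^ 2 := by positivity
    linarith
  have hlt : ∑ a, ((localSupport F W a).card : ℝ) * ((1 - hat F 0) * (hatSupport F).card)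
      < ∑ a, (1 - |cosetPart F W 0 a|) * ((cosetSupport F W).card : ℝ) ^ 2 := by
    refine Finset.sum_lt_sum (fun a _ => ?_) ?_
    · by_cases h : (localSupport F W a).Nonempty
      · exact (hcon a h).le
      · rw [Finset.not_nonempty_iff_eq_empty.1 h, Finset.card_empty, Nat.cast_zero, zero_mul]
        exact mul_nonneg (sub_nonneg.2 (hle a)) (by positivity)
    · obtain ⟨a, ha⟩ := hex
      exact ⟨a, Finset.mem_univ a, hcon a ha⟩
  rw [← Finset.sum_mul, ← Finset.sum_mul] at hlt
  have h2 : ∑ a, (1 - |cosetPart F W 0 a|) ≤ 2 ^ n * (1 - hat F 0) := by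
    have h3 : ∑ a, (1 - |cosetPart F W 0 a|) ≤ ∑ a, (1 - cosetPart F W 0 a) :=
      Finset.sum_le_sum fun a _ => sub_le_sub_left (le_abs_self _) _
    have h4 : ∑ a, (1 - cosetPart F W 0 a) = 2 ^ n * (1 - hat F 0) := by
      rw [Finset.sum_sub_distrib, sum_cosetPart_zero]
      simp [mul_sub]
    linarith
  have h4 := mul_le_mul_of_nonneg_right h2 (sq_nonneg ((cosetSupport F W).card : ℝ))
  have h5 := mul_le_mul_of_nonneg_left hsum (sub_nonneg.2 hδ)
  linarith

lemma harmonic_sub_ge {K' K : ℕ} (h : K' ≤ K) (hK : 0 < K) :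
    ((K : ℝ) - K') / K ≤ (harmonic K : ℝ) - harmonic K' := by
  obtain ⟨d, rfl⟩ := Nat.exists_eq_add_of_le h
  have h1 : (harmonic (K' + d) : ℝ) - harmonic K'
      = ∑ i ∈ Finset.range d, (((K' + i + 1 : ℕ) : ℝ))⁻¹ := by
    rw [harmonic, harmonic, Finset.sum_range_add]
    push_cast
    ring
  have h2 : ∑ i ∈ Finset.range d, (((K' + d : ℕ) : ℝ))⁻¹
      ≤ ∑ i ∈ Finset.range d, (((K' + i + 1 : ℕ) : ℝ))⁻¹ := by
    refine Finset.sum_le_sum fun i hi => inv_anti₀ (by positivity) ?_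
    have := Finset.mem_range.1 hi
    exact_mod_cast (by omega : K' + i + 1 ≤ K' + d)
  rw [h1]
  refine le_trans (le_of_eq ?_) h2
  rw [Finset.sum_const, Finset.card_range, nsmul_eq_mul, div_eq_mul_inv]
  push_cast
  ring

/-- The Fourier support lies in a subspace of dimension `O(√(δ k) log k)`. -/
lemma exists_cosetSupport_eq_empty {n : ℕ} {F : (Fin n → ZMod 2) → ℝ}
    (hF : ∀ x, F x = 1 ∨ F x = -1) (hδ : hat F 0 ≤ 1) (K : ℕ) :
    ∀ W : Submodule (ZMod 2) (Fin n → ZMod 2), (cosetSupport F W).card = K →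
      ∃ W' : Submodule (ZMod 2) (Fin n → ZMod 2), cosetSupport F W' = ∅ ∧
        (Module.finrank (ZMod 2) W' : ℝ) ≤ Module.finrank (ZMod 2) W
          + 6 * √((1 - hat F 0) * (hatSupport F).card) * harmonic K := by
  induction K using Nat.strong_induction_on with
  | _ K ih =>
    intro W hW
    rcases (cosetSupport F W).eq_empty_or_nonempty with hemp | hne
    · refine ⟨W, hemp, ?_⟩
      have : K = 0 := by rw [← hW, hemp, Finset.card_empty]
      simp [this]
    obtain ⟨a, hN, ha⟩ := exists_localSupport_large W hne hδ
      (fun a => abs_cosetPart_le_one hF W 0 a)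
    obtain ⟨W₁, b, hle, hb, hfin, hP⟩ := exists_const_of_localSupport hF W a hN
    have hmerge := two_mul_card_cosetSupport_add_le hF hle hP
    rw [localSupport_translate F hb, hW] at hmerge
    have hNpos := hN.card_pos
    have hKpos : 0 < K := by rw [← hW]; exact hne.card_pos
    obtain ⟨W', hW', hfin'⟩ := ih (cosetSupport F W₁).card (by omega) W₁ rfl
    refine ⟨W', hW', ?_⟩
    have hharm := harmonic_sub_ge (K' := (cosetSupport F W₁).card) (K := K) (by omega) hKpos
    have hmerge' : 2 * ((cosetSupport F W₁).card : ℝ) + (localSupport F W a).card ≤ 2 * K := by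
      exact_mod_cast hmerge
    rw [hW] at ha
    set s : ℝ := ((localSupport F W a).card : ℝ)
    set y := 1 - |cosetPart F W 0 a|
    set D := (1 - hat F 0) * (hatSupport F).card
    have hs : 0 ≤ s := Nat.cast_nonneg _
    have hK : (0 : ℝ) < K := by exact_mod_cast hKpos
    have h1 : √(y * s) ≤ √D * (s / K) := by
      rw [← Real.sqrt_sq (by positivity : 0 ≤ s / K), ← Real.sqrt_mul' _ (sq_nonneg _)]
      refine Real.sqrt_le_sqrt ?_
      rw [div_pow, ← mul_div_assoc, le_div_iff₀ (by positivity)]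
      nlinarith
    have h2 : s / K ≤ 2 * ((harmonic K : ℝ) - harmonic (cosetSupport F W₁).card) := by
      refine le_trans ?_ (mul_le_mul_of_nonneg_left hharm (by norm_num))
      rw [← mul_div_assoc]
      exact div_le_div_of_nonneg_right (by linarith) hK.le
    have h3 := mul_le_mul_of_nonneg_left h2 (Real.sqrt_nonneg D)
    linarith

lemma finrank_span_hatSupport_le {n : ℕ} {F : (Fin n → ZMod 2) → ℝ}
    (hF : ∀ x, F x = 1 ∨ F x = -1) (hδ : hat F 0 ≤ 1) :
    (Module.finrank (ZMod 2)
        (Submodule.span (ZMod 2) (hatSupport F : Set (Fin n → ZMod 2))) : ℝ)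
      ≤ 6 * √((1 - hat F 0) * (hatSupport F).card) * harmonic (hatSupport F).card := by
  obtain ⟨W, hW, hfin⟩ := exists_cosetSupport_eq_empty hF hδ _ ⊥ rfl
  have hspan : Submodule.span (ZMod 2) (hatSupport F : Set (Fin n → ZMod 2)) ≤ W := by
    refine Submodule.span_le.2 fun s hs => ?_
    by_contra hsW
    have : W.mkQ s ∈ cosetSupport F W :=
      mem_cosetSupport.2 ⟨fun h => hsW (by simpa using h), s, hs, rfl⟩
    simp [hW] at this
  have hcard : (cosetSupport F ⊥).card ≤ (hatSupport F).card := by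
    refine (Finset.card_le_card fun q hq => ?_).trans
      (Finset.card_image_le (f := (⊥ : Submodule (ZMod 2) (Fin n → ZMod 2)).mkQ))
    obtain ⟨_, s, hs, hsq⟩ := mem_cosetSupport.1 hq
    exact Finset.mem_image.2 ⟨s, hs, hsq⟩
  have hharm : (harmonic (cosetSupport F ⊥).card : ℝ) ≤ harmonic (hatSupport F).card := by
    rcases Nat.eq_zero_or_pos (hatSupport F).card with h | h
    · rw [h] at hcard ⊢; rw [Nat.le_zero.1 hcard]
    · have := harmonic_sub_ge hcard h
      have h2 : (0 : ℝ) ≤ (((hatSupport F).card : ℝ) - (cosetSupport F ⊥).card)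
          / (hatSupport F).card :=
        div_nonneg (sub_nonneg.2 (by exact_mod_cast hcard)) (Nat.cast_nonneg _)
      linarith
  have h1 : (Module.finrank (ZMod 2)
      (Submodule.span (ZMod 2) (hatSupport F : Set (Fin n → ZMod 2))) : ℝ)
      ≤ Module.finrank (ZMod 2) W := by
    exact_mod_cast Submodule.finrank_mono hspan
  rw [finrank_bot, Nat.cast_zero, zero_add] at hfin
  exact h1.trans (hfin.trans (mul_le_mul_of_nonneg_left hharm (by positivity)))

lemma sum_sg_subcube_eq_zero {n : ℕ} (U : Finset (Fin n)) {z : Fin n → ZMod 2} {j : Fin n}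
    (hj : j ∉ U) (hz : z j ≠ 0) :
    ∑ x with ∀ i ∈ U, x i = 1, sg (z ⬝ᵥ x) = 0 := by
  have h1 : z ⬝ᵥ Pi.single j 1 = 1 := by simpa using zmod_two_eq_one hz
  rw [Finset.sum_filter]
  have h := Equiv.sum_comp (Equiv.addRight (Pi.single j (1 : ZMod 2)))
    (fun x : Fin n → ZMod 2 => if ∀ i ∈ U, x i = 1 then sg (z ⬝ᵥ x) else 0)
  have h2 : ∀ x : Fin n → ZMod 2,
      (∀ i ∈ U, (x + (Pi.single j (1 : ZMod 2) : Fin n → ZMod 2)) i = 1) ↔ ∀ i ∈ U, x i = 1 := by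
    intro x
    refine forall₂_congr fun i hi => ?_
    have : i ≠ j := fun h => hj (h ▸ hi)
    simp [this]
  simp only [Equiv.coe_addRight, h2, dotProduct_add, sg_add, h1, sg_one, mul_neg, mul_one] at h
  have h3 : ∀ x : Fin n → ZMod 2, (if ∀ i ∈ U, x i = 1 then -sg (z ⬝ᵥ x) else 0)
      = -(if ∀ i ∈ U, x i = 1 then sg (z ⬝ᵥ x) else 0) := by
    intro x; split_ifs <;> simp
  simp only [h3, Finset.sum_neg_distrib] at h
  linarith

lemma card_subcube {n : ℕ} (U : Finset (Fin n)) :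
    (Finset.univ.filter (fun x : Fin n → ZMod 2 => ∀ i ∈ U, x i = 1)).card
      = 2 ^ (n - U.card) := by
  have h : Finset.univ.filter (fun x : Fin n → ZMod 2 => ∀ i ∈ U, x i = 1)
      = Fintype.piFinset (fun i => if i ∈ U then {1} else Finset.univ) := by
    ext x
    rw [Finset.mem_filter, Fintype.mem_piFinset]
    simp only [Finset.mem_univ, true_and]
    refine forall_congr' fun i => ?_
    split_ifs with hi <;> simp [hi]
  rw [h, Fintype.card_piFinset]
  have h2 : ∀ i, (if i ∈ U then ({1} : Finset (ZMod 2)) else Finset.univ).card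
      = if i ∈ U then 1 else 2 := by
    intro i; split_ifs <;> simp
  simp only [h2]
  rw [Finset.prod_ite, Finset.prod_const_one, one_mul, Finset.prod_const]
  congr 1
  rw [← Finset.compl_filter, Finset.card_compl, Fintype.card_fin]
  simp

/-- A sign function of sparsity `k` has evenly many `-1`s on each subcube of size above `k`. -/
lemma even_card_subcube {n : ℕ} {F : (Fin n → ZMod 2) → ℝ} (hF : ∀ x, F x = 1 ∨ F x = -1)
    (hk : 1 < (hatSupport F).card) (U : Finset (Fin n))
    (hU : (hatSupport F).card < 2 ^ (n - U.card)) :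
    Even (Finset.univ.filter (fun x => F x = -1 ∧ ∀ i ∈ U, x i = 1)).card := by
  obtain ⟨R, hR⟩ : ∃ R : {i // i ∉ U} → ZMod 2, ∀ s ∈ hatSupport F, (fun i => s i.1) ≠ R := by
    by_contra! hcon
    have h1 : Finset.univ ⊆ (hatSupport F).image
        (fun s => fun i : {i // i ∉ U} => s i.1) := fun R _ => by
      obtain ⟨s, hs, h⟩ := hcon R
      exact Finset.mem_image.2 ⟨s, hs, h⟩
    have h2 := (Finset.card_le_card h1).trans Finset.card_image_le
    rw [Finset.card_univ, Fintype.card_fun, ZMod.card, Fintype.card_subtype_compl,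
      Fintype.card_fin, Fintype.card_coe] at h2
    omega
  set S : Fin n → ZMod 2 := fun i => if h : i ∈ U then 0 else R ⟨i, h⟩ with hS
  set H := Finset.univ.filter (fun x : Fin n → ZMod 2 => ∀ i ∈ U, x i = 1) with hH
  obtain ⟨m, hm⟩ : ∃ m, n - U.card = m + 2 := by
    refine ⟨n - U.card - 2, ?_⟩
    by_contra hne
    have : n - U.card ≤ 1 := by omega
    have := Nat.pow_le_pow_right (n := 2) (by norm_num) this
    omega
  have hHcard : H.card = 4 * 2 ^ m := by rw [hH, card_subcube, hm]; ring
  have hHS : ∃ j : ℕ, ∑ x ∈ H, sg (S ⬝ᵥ x) = 4 * j := by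
    by_cases hR0 : ∃ i, R i ≠ 0
    · obtain ⟨⟨i, hi⟩, hRi⟩ := hR0
      refine ⟨0, ?_⟩
      rw [hH, sum_sg_subcube_eq_zero U hi (by simpa [hS, hi] using hRi)]
      simp
    · push Not at hR0
      have : S = 0 := by
        ext i; simp only [hS]; split_ifs <;> simp [hR0]
      refine ⟨2 ^ m, ?_⟩
      simp [this, sg_zero, hHcard]
  have hFS : ∑ x ∈ H, F x * sg (S ⬝ᵥ x) = 0 := by
    have h1 : ∀ x, F x * sg (S ⬝ᵥ x) = ∑ T, hat F T * sg ((T + S) ⬝ᵥ x) := by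
      intro x
      rw [← hat_inversion F x, Finset.sum_mul]
      simp only [add_dotProduct, sg_add, mul_assoc]
    simp only [h1]
    rw [Finset.sum_comm]
    simp only [← Finset.mul_sum]
    refine Finset.sum_eq_zero fun T _ => ?_
    by_cases hT : hat F T = 0
    · rw [hT, zero_mul]
    · obtain ⟨⟨i, hi⟩, hne⟩ := Function.ne_iff.1 (hR T (mem_hatSupport.2 hT))
      rw [hH, sum_sg_subcube_eq_zero U hi, mul_zero]
      simp only [hS, Pi.add_apply, hi, dite_false]
      intro h
      exact hne (CharTwo.add_eq_zero.1 h)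
  have hsplit : ∑ x ∈ H, F x * sg (S ⬝ᵥ x)
      = ∑ x ∈ H, sg (S ⬝ᵥ x) - 2 * ∑ x ∈ H with F x = -1, sg (S ⬝ᵥ x) := by
    have e : ∑ x ∈ H with F x = -1, sg (S ⬝ᵥ x)
        = ∑ x ∈ H, if F x = -1 then sg (S ⬝ᵥ x) else 0 := Finset.sum_filter _ _
    rw [e, Finset.mul_sum, ← Finset.sum_sub_distrib]
    refine Finset.sum_congr rfl fun x _ => ?_
    rcases hF x with h | h <;> rw [h] <;> norm_num
    ring
  have hcount : ∑ x ∈ H with F x = -1, sg (S ⬝ᵥ x)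
      = ((H.filter (fun x => F x = -1)).card : ℝ)
        - 2 * (((H.filter (fun x => F x = -1)).filter (fun x => S ⬝ᵥ x ≠ 0)).card : ℝ) := by
    rw [Finset.card_filter _ (H.filter _), Nat.cast_sum, Finset.mul_sum, Finset.cast_card,
      ← Finset.sum_sub_distrib]
    refine Finset.sum_congr rfl fun x _ => ?_
    unfold sg
    by_cases h : S ⬝ᵥ x = 0
    · simp [h]
    · simp [h]; norm_num
  obtain ⟨j, hj⟩ := hHS
  have hfilter : Finset.univ.filter (fun x => F x = -1 ∧ ∀ i ∈ U, x i = 1)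
      = H.filter (fun x => F x = -1) := by
    rw [hH, Finset.filter_filter]
    exact Finset.filter_congr fun x _ => and_comm
  rw [hfilter]
  set N := (H.filter (fun x => F x = -1)).card
  set N' := ((H.filter (fun x => F x = -1)).filter (fun x => S ⬝ᵥ x ≠ 0)).card
  have : (N : ℝ) = ((2 * (j + N') : ℕ) : ℝ) := by push_cast; linarith
  exact ⟨j + N', by rw [Nat.cast_inj.1 this]; ring⟩

lemma card_add_card_le_of_orthogonal {X α β : Type*} [Fintype X] [Fintype α] [Fintype β]
    {u : α → X → ZMod 2} {v : β → X → ZMod 2} (hu : LinearIndependent (ZMod 2) u)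
    (hv : LinearIndependent (ZMod 2) v) (huv : ∀ a b, u a ⬝ᵥ v b = 0) :
    Fintype.card α + Fintype.card β ≤ Fintype.card X := by
  have h1 := Subspace.finrank_add_finrank_dualAnnihilator_eq
    (Submodule.span (ZMod 2) (Set.range u))
  rw [finrank_span_eq_card hu, Module.finrank_fintype_fun_eq_card] at h1
  have h2 : (Submodule.span (ZMod 2) (Set.range v)).map
      (dotProductEquiv (ZMod 2) X : (X → ZMod 2) →ₗ[ZMod 2] Module.Dual (ZMod 2) (X → ZMod 2))
      ≤ (Submodule.span (ZMod 2) (Set.range u)).dualAnnihilator := by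
    rw [Submodule.map_span_le]
    rintro _ ⟨b, rfl⟩
    rw [Submodule.mem_dualAnnihilator]
    intro w hw
    have : Submodule.span (ZMod 2) (Set.range u)
        ≤ LinearMap.ker (dotProductEquiv (ZMod 2) X (v b)) := by
      rw [Submodule.span_le]
      rintro _ ⟨a, rfl⟩
      simpa [dotProduct_comm] using huv a b
    exact this hw
  have h3 := Submodule.finrank_mono h2
  rw [LinearEquiv.finrank_map_eq, finrank_span_eq_card hv] at h3
  omega

/-- The set of coordinates at which `x` is `1`. -/
def ones {n : ℕ} (x : Fin n → ZMod 2) : Finset (Fin n) := Finset.univ.filter (fun i => x i = 1)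

lemma mem_ones {n : ℕ} {x : Fin n → ZMod 2} {i : Fin n} : i ∈ ones x ↔ x i = 1 := by
  simp [ones]

lemma ones_injective {n : ℕ} : Function.Injective (ones (n := n)) := by
  intro x y h
  ext i
  have h1 : x i = 1 ↔ y i = 1 := by rw [← mem_ones, ← mem_ones, h]
  revert h1
  generalize x i = a
  generalize y i = b
  revert a b
  decide

lemma prod_coord_eq {n : ℕ} (T : Finset (Fin n)) (x : Fin n → ZMod 2) :
    ∏ i ∈ T, x i = if T ⊆ ones x then 1 else 0 := by
  split_ifs with h
  · exact Finset.prod_eq_one fun i hi => mem_ones.1 (h hi)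
  · obtain ⟨i, hi, hne⟩ := Finset.not_subset.1 h
    refine Finset.prod_eq_zero hi ?_
    by_contra h0
    exact hne (mem_ones.2 (zmod_two_eq_one h0))

/-- Monomials attached to the points of a set are independent as functions on that set. -/
lemma linearIndependent_monomials {n : ℕ} {A B : Finset (Fin n → ZMod 2)} (hBA : B ⊆ A) :
    LinearIndependent (ZMod 2) (fun (y : B) (x : A) => ∏ i ∈ ones y.1, x.1 i) := by
  rw [Fintype.linearIndependent_iff]
  intro g hg
  by_contra! hne
  obtain ⟨y₀, hy₀⟩ := hne
  obtain ⟨y, hy, hmin⟩ := Finset.exists_min_image (Finset.univ.filter (fun y : B => g y ≠ 0))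
    (fun y => (ones y.1).card) ⟨y₀, by simp [hy₀]⟩
  have h := congrFun hg ⟨y.1, hBA y.2⟩
  simp only [Finset.sum_apply, Pi.smul_apply, smul_eq_mul, prod_coord_eq, Pi.zero_apply] at h
  rw [Finset.sum_eq_single y] at h
  · simp only [subset_refl, if_true, mul_one] at h
    exact (Finset.mem_filter.1 hy).2 h
  · intro z _ hzy
    by_cases hz : g z = 0
    · rw [hz, zero_mul]
    · rw [if_neg, mul_zero]
      intro hsub
      have h1 := hmin z (by simp [hz])
      exact hzy (Subtype.ext (ones_injective (Finset.eq_of_subset_of_card_le hsub h1)))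
  · intro h; simp at h

lemma card_low_add_card_low_le {n d : ℕ} {F : (Fin n → ZMod 2) → ℝ}
    (hF : ∀ x, F x = 1 ∨ F x = -1) (hk : 1 < (hatSupport F).card)
    (hd : (hatSupport F).card < 2 ^ (d + 1)) {s t : ℕ} (hst : s + t + d + 1 ≤ n) :
    ((Finset.univ.filter (fun x => F x = -1)).filter (fun x => (ones x).card ≤ s)).card
      + ((Finset.univ.filter (fun x => F x = -1)).filter (fun x => (ones x).card ≤ t)).card
      ≤ (Finset.univ.filter (fun x => F x = -1)).card := by
  set A := Finset.univ.filter (fun x => F x = -1) with hA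
  have h := card_add_card_le_of_orthogonal
    (linearIndependent_monomials (Finset.filter_subset (fun x => (ones x).card ≤ s) A))
    (linearIndependent_monomials (Finset.filter_subset (fun x => (ones x).card ≤ t) A)) ?_
  · simpa only [Fintype.card_coe] using h
  rintro ⟨y, hy⟩ ⟨z, hz⟩
  have hy' := (Finset.mem_filter.1 hy).2
  have hz' := (Finset.mem_filter.1 hz).2
  have hcard : (ones y ∪ ones z).card ≤ s + t :=
    (Finset.card_union_le _ _).trans (add_le_add hy' hz')
  have heven := even_card_subcube hF hk (ones y ∪ ones z)
    (hd.trans_le (Nat.pow_le_pow_right (by norm_num) (by omega)))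
  simp only [dotProduct, prod_coord_eq]
  rw [Finset.sum_coe_sort A (fun x => (if ones y ⊆ ones x then (1 : ZMod 2) else 0)
    * if ones z ⊆ ones x then 1 else 0)]
  have h1 : ∀ x : Fin n → ZMod 2, (if ones y ⊆ ones x then (1 : ZMod 2) else 0)
      * (if ones z ⊆ ones x then 1 else 0)
      = if ∀ i ∈ ones y ∪ ones z, x i = 1 then 1 else 0 := by
    intro x
    have : (∀ i ∈ ones y ∪ ones z, x i = 1) ↔ ones y ⊆ ones x ∧ ones z ⊆ ones x := by
      rw [← Finset.union_subset_iff]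
      exact forall₂_congr fun i _ => mem_ones.symm
    simp only [this, ite_and]
    split_ifs <;> simp
  simp only [h1]
  rw [Finset.sum_boole, hA, Finset.filter_filter]
  exact (ZMod.natCast_eq_zero_iff_even).2 heven

/-- The average Hamming weight on the `-1`-set of `F` is at least `(n - d) / 2`. -/
lemma mul_card_le_two_mul_sum_card_ones {n d : ℕ} {F : (Fin n → ZMod 2) → ℝ}
    (hF : ∀ x, F x = 1 ∨ F x = -1) (hk : 1 < (hatSupport F).card)
    (hd : (hatSupport F).card < 2 ^ (d + 1)) :
    (n - d) * (Finset.univ.filter (fun x => F x = -1)).card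
      ≤ 2 * ∑ x with F x = -1, (ones x).card := by
  set A := Finset.univ.filter (fun x => F x = -1)
  set c : ℕ → ℕ := fun t => (A.filter (fun x => t < (ones x).card)).card
  have hsum : ∑ x ∈ A, (ones x).card = ∑ t ∈ Finset.range n, c t := by
    have h1 : ∀ x : Fin n → ZMod 2, (ones x).card
        = ∑ t ∈ Finset.range n, if t < (ones x).card then 1 else 0 := by
      intro x
      rw [← Finset.card_filter]
      have h2 : (ones x).card ≤ n := by simpa using Finset.card_le_univ (ones x)
      have : (Finset.range n).filter (fun t => t < (ones x).card)
          = Finset.range (ones x).card := by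
        ext t; simp; omega
      rw [this, Finset.card_range]
    simp only [c, Finset.card_filter]
    rw [Finset.sum_comm]
    exact Finset.sum_congr rfl fun x _ => h1 x
  have hc : ∀ t, c t + (A.filter (fun x => (ones x).card ≤ t)).card = A.card := by
    intro t
    rw [← Finset.card_filter_add_card_filter_not (s := A) (fun x => t < (ones x).card)]
    simp only [not_lt, c]
  have hpair : ∀ t ∈ Finset.range (n - d), A.card ≤ c t + c (n - d - 1 - t) := by
    intro t ht
    have := Finset.mem_range.1 ht
    have h1 : (A.filter (fun x => (ones x).card ≤ t)).card
        + (A.filter (fun x => (ones x).card ≤ n - d - 1 - t)).card ≤ A.card :=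
      card_low_add_card_low_le hF hk hd (by omega)
    have h2 := hc t
    have h3 := hc (n - d - 1 - t)
    omega
  have h1 := Finset.sum_le_sum hpair
  rw [Finset.sum_const, Finset.card_range, smul_eq_mul, Finset.sum_add_distrib,
    Finset.sum_range_reflect c (n - d)] at h1
  have h2 : ∑ t ∈ Finset.range (n - d), c t ≤ ∑ t ∈ Finset.range n, c t :=
    Finset.sum_le_sum_of_subset (Finset.range_subset_range.2 (Nat.sub_le n d))
  rw [hsum]
  omega

lemma sum_sg_coord {n : ℕ} (x : Fin n → ZMod 2) :
    ∑ i, sg (x i) = n - 2 * (ones x).card := by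
  have h : ∀ i, sg (x i) = 1 - 2 * (if x i = 1 then 1 else 0) := by
    intro i
    by_cases h : x i = 0
    · simp [h, sg_zero]
    · rw [zmod_two_eq_one h, sg_one]; norm_num
  simp only [h]
  rw [Finset.sum_sub_distrib, ← Finset.mul_sum, Finset.sum_boole]
  simp [ones]

lemma sum_sum_sg_coord_le {n d : ℕ} {F : (Fin n → ZMod 2) → ℝ}
    (hF : ∀ x, F x = 1 ∨ F x = -1) (hk : 1 < (hatSupport F).card)
    (hd : (hatSupport F).card < 2 ^ (d + 1)) :
    ∑ i, ∑ x with F x = -1, sg (x i)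
      ≤ d * ((Finset.univ.filter (fun x => F x = -1)).card : ℝ) := by
  rw [Finset.sum_comm]
  simp only [sum_sg_coord]
  have h := mul_card_le_two_mul_sum_card_ones hF hk hd
  have h' : ((n : ℝ) - d) * (Finset.univ.filter (fun x => F x = -1)).card
      ≤ 2 * ∑ x with F x = -1, ((ones x).card : ℝ) := by
    have h1 : ((n : ℝ) - d) ≤ ((n - d : ℕ) : ℝ) := by
      rw [sub_le_iff_le_add]; exact_mod_cast le_tsub_add
    refine (mul_le_mul_of_nonneg_right h1 (Nat.cast_nonneg _)).trans ?_
    exact_mod_cast h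
  rw [Finset.sum_sub_distrib, ← Finset.mul_sum, Finset.sum_const, nsmul_eq_mul]
  linarith

lemma sum_abs_sum_sg_basis_le {n d : ℕ} {F : (Fin n → ZMod 2) → ℝ}
    (hF : ∀ x, F x = 1 ∨ F x = -1) (hk : 1 < (hatSupport F).card)
    (hd : (hatSupport F).card < 2 ^ (d + 1))
    (b : Module.Basis (Fin n) (ZMod 2) (Fin n → ZMod 2)) :
    ∑ i, |∑ x with F x = -1, sg (b i ⬝ᵥ x)|
      ≤ d * ((Finset.univ.filter (fun x => F x = -1)).card : ℝ) := by
  have hc : ∀ i, ∃ a : ZMod 2, |∑ x with F x = -1, sg (b i ⬝ᵥ x)|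
      = ∑ x with F x = -1, sg (b i ⬝ᵥ x + a) := by
    intro i
    rcases abs_choice (∑ x with F x = -1, sg (b i ⬝ᵥ x)) with h | h
    · exact ⟨0, by simpa using h⟩
    · exact ⟨1, by simpa [sg_add, sg_one] using h⟩
  choose c hc using hc
  have hinj : Function.Injective (fun (x : Fin n → ZMod 2) i => b i ⬝ᵥ x + c i) := by
    intro x y hxy
    have h1 : ∀ i, b i ⬝ᵥ x = b i ⬝ᵥ y := fun i => add_right_cancel (congrFun hxy i)
    refine dotProduct_eq _ _ fun v => ?_
    rw [← b.sum_repr v, dotProduct_comm x, dotProduct_comm y, sum_dotProduct, sum_dotProduct]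
    simp only [smul_dotProduct, h1]
  let e : (Fin n → ZMod 2) ≃ (Fin n → ZMod 2) :=
    Equiv.ofBijective _ (Finite.injective_iff_bijective.1 hinj)
  have he : ∀ x i, e x i = b i ⬝ᵥ x + c i := fun _ _ => rfl
  have hat_comp : ∀ s, hat (fun y => F (e.symm y)) s
      = sg (s ⬝ᵥ c) * hat F (b.equivFun.symm s) := by
    intro s
    rw [hat, hat, ← mul_div_assoc, ← Equiv.sum_comp e, Finset.mul_sum]
    congr 1
    refine Finset.sum_congr rfl fun x _ => ?_
    have : s ⬝ᵥ e x = b.equivFun.symm s ⬝ᵥ x + s ⬝ᵥ c := by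
      rw [b.equivFun_symm_apply, sum_dotProduct]
      simp only [smul_dotProduct, smul_eq_mul]
      simp only [dotProduct.eq_def s, he, mul_add, Finset.sum_add_distrib]
    rw [this, sg_add, Equiv.symm_apply_apply]; ring
  have hcard : (hatSupport (fun y => F (e.symm y))).card = (hatSupport F).card := by
    refine Finset.card_equiv b.equivFun.symm.toEquiv fun s => ?_
    have : sg (s ⬝ᵥ c) ≠ 0 := by rcases sg_eq (s ⬝ᵥ c) with h | h <;> rw [h] <;> norm_num
    simp [mem_hatSupport, hat_comp, this]
  have hsum : ∀ φ : (Fin n → ZMod 2) → ℝ,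
      ∑ y with F (e.symm y) = -1, φ y = ∑ x with F x = -1, φ (e x) := by
    intro φ
    rw [Finset.sum_filter, Finset.sum_filter, ← Equiv.sum_comp e]
    simp only [Equiv.symm_apply_apply]
  have h := sum_sum_sg_coord_le (F := fun y => F (e.symm y)) (d := d) (fun y => hF _)
    (by rwa [hcard]) (by rwa [hcard])
  have hcard' : ((Finset.univ.filter (fun y => F (e.symm y) = -1)).card : ℝ)
      = (Finset.univ.filter (fun x => F x = -1)).card := by
    simpa using hsum (fun _ => 1)
  simp only [hsum, he, ← hc] at h
  rwa [hcard'] at h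

lemma sum_abs_hat_basis_le {n d : ℕ} {F : (Fin n → ZMod 2) → ℝ}
    (hF : ∀ x, F x = 1 ∨ F x = -1) (hk : 1 < (hatSupport F).card)
    (hd : (hatSupport F).card < 2 ^ (d + 1)) {ι : Type*} [Fintype ι]
    (b : Module.Basis ι (ZMod 2) (Fin n → ZMod 2)) :
    ∑ i, |hat F (b i)|
      ≤ 2 * d * (((Finset.univ.filter (fun x => F x = -1)).card : ℝ) / 2 ^ n) := by
  have hι : Fintype.card ι = n := by
    rw [← Module.finrank_eq_card_basis b, Module.finrank_fintype_fun_eq_card, Fintype.card_fin]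
  have h := sum_abs_sum_sg_basis_le hF hk hd (b.reindex (Fintype.equivFinOfCardEq hι))
  rw [← Equiv.sum_comp (Fintype.equivFinOfCardEq hι)] at h
  simp only [Module.Basis.reindex_apply, Equiv.symm_apply_apply] at h
  have h1 : ∀ i, |hat F (b i)| = 2 / 2 ^ n * |∑ x with F x = -1, sg (b i ⬝ᵥ x)| := by
    intro i
    rw [hat_eq_of_sign hF, if_neg (b.ne_zero i), zero_sub, abs_neg, mul_div_right_comm, abs_mul,
      abs_of_nonneg (by positivity : (0 : ℝ) ≤ 2 / 2 ^ n)]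
  simp only [h1]
  rw [← Finset.mul_sum]
  refine (mul_le_mul_of_nonneg_left h (by positivity)).trans (le_of_eq ?_)
  ring

lemma finrank_span_mul_le {n d : ℕ} {F : (Fin n → ZMod 2) → ℝ}
    (hF : ∀ x, F x = 1 ∨ F x = -1) (hk : 1 < (hatSupport F).card)
    (hd : (hatSupport F).card < 2 ^ (d + 1)) {T : Set (Fin n → ZMod 2)} {a : ℝ}
    (hT : ∀ s ∈ T, a ≤ |hat F s|) :
    (Module.finrank (ZMod 2) (Submodule.span (ZMod 2) T) : ℝ) * a
      ≤ 2 * d * (((Finset.univ.filter (fun x => F x = -1)).card : ℝ) / 2 ^ n) := by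
  obtain ⟨B, hBT, hspan, hB⟩ := exists_linearIndependent (ZMod 2) T
  have hB' : LinearIndepOn (ZMod 2) id B := hB
  refine le_trans ?_ (sum_abs_hat_basis_le hF hk hd (Module.Basis.extend hB'))
  rw [← hspan, finrank_span_set_eq_card hB', ← nsmul_eq_mul]
  have hBE := hB'.subset_extend (Set.subset_univ B)
  have hcard : B.toFinset.card
      = (Finset.univ.filter (fun i : hB'.extend (Set.subset_univ B) => i.1 ∈ B)).card := by
    refine Finset.card_bij (fun s hs => ⟨s, hBE (Set.mem_toFinset.1 hs)⟩) ?_ ?_ ?_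
    · intro s hs; simpa using hs
    · intro s _ t _ h; exact congrArg Subtype.val h
    · intro s hs; exact ⟨s.1, by simpa using hs, rfl⟩
  rw [hcard]
  refine (Finset.card_nsmul_le_sum _ (fun i => |hat F (Module.Basis.extend hB' i)|) _
    fun i hi => ?_).trans (Finset.sum_le_univ_sum_of_nonneg fun i => abs_nonneg _)
  rw [Module.Basis.extend_apply_self]
  exact hT _ (hBT (Finset.mem_filter.1 hi).2)

/-- The identification of `Bool` with `ZMod 2` sending `true` to `1`. -/
def boolEquivZMod : Bool ≃ ZMod 2 where
  toFun b := if b then 1 else 0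
  invFun a := decide (a = 1)
  left_inv b := by cases b <;> simp
  right_inv a := by
    by_cases h : a = 0
    · simp [h]
    · simp [zmod_two_eq_one h]

/-- The identification of the Boolean cube with `F₂ⁿ`. -/
def cubeEquiv (n : ℕ) : (Fin n → Bool) ≃ (Fin n → ZMod 2) :=
  Equiv.arrowCongr (Equiv.refl _) boolEquivZMod

lemma sg_boolEquivZMod (b : Bool) : sg (boolEquivZMod b) = signv b := by
  cases b <;> simp [boolEquivZMod, signv, sg]

lemma sg_sum {ι : Type*} (S : Finset ι) (g : ι → ZMod 2) :
    sg (∑ i ∈ S, g i) = ∏ i ∈ S, sg (g i) := by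
  induction S using Finset.induction_on with
  | empty => simp [sg_zero]
  | insert i S hi ih => rw [Finset.sum_insert hi, Finset.prod_insert hi, sg_add, ih]

lemma fourierCoeff_eq_hat {n : ℕ} (f : (Fin n → Bool) → ℝ) (S : Finset (Fin n)) :
    fourierCoeff f S = hat (fun v => f ((cubeEquiv n).symm v)) (indicatorVec S) := by
  rw [fourierCoeff, hat, ← Equiv.sum_comp (cubeEquiv n)]
  congr 1
  refine Finset.sum_congr rfl fun x _ => ?_
  have : indicatorVec S ⬝ᵥ cubeEquiv n x = ∑ i ∈ S, boolEquivZMod (x i) := by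
    simp [dotProduct, indicatorVec, cubeEquiv]
  rw [this, sg_sum, Equiv.symm_apply_apply]
  simp only [sg_boolEquivZMod]

lemma indicatorVec_ones {n : ℕ} (s : Fin n → ZMod 2) : indicatorVec (ones s) = s := by
  ext i
  by_cases h : s i = 0
  · simp [indicatorVec, mem_ones, h]
  · simp [indicatorVec, mem_ones, zmod_two_eq_one h]

lemma ones_indicatorVec {n : ℕ} (S : Finset (Fin n)) : ones (indicatorVec S) = S := by
  ext i; simp [indicatorVec, mem_ones]

lemma indicatorVec_surjective {n : ℕ} : Function.Surjective (indicatorVec (n := n)) :=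
  fun s => ⟨ones s, indicatorVec_ones s⟩

lemma sparsity_eq {n : ℕ} (f : (Fin n → Bool) → ℝ) :
    sparsity f = (hatSupport (fun v => f ((cubeEquiv n).symm v))).card := by
  refine Finset.card_equiv ⟨indicatorVec, ones, ones_indicatorVec, indicatorVec_ones⟩ fun S => ?_
  simp [fourierSupport, mem_hatSupport, fourierCoeff_eq_hat]

lemma fourierRank_eq {n : ℕ} (f : (Fin n → Bool) → ℝ) :
    fourierRank f = Module.finrank (ZMod 2) (Submodule.span (ZMod 2)
      (hatSupport (fun v => f ((cubeEquiv n).symm v)) : Set (Fin n → ZMod 2))) := by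
  have h : indicatorVec '' (fourierSupport f : Set (Finset (Fin n)))
      = (hatSupport (fun v => f ((cubeEquiv n).symm v)) : Set (Fin n → ZMod 2)) := by
    simp only [fourierSupport, hatSupport, fourierCoeff_eq_hat, Finset.coe_filter,
      Finset.mem_univ, true_and]
    exact Set.image_preimage_eq {s | hat _ s ≠ 0} indicatorVec_surjective
  rw [fourierRank, h]

lemma levelDim_eq {n : ℕ} (f : (Fin n → Bool) → ℝ) (t : ℝ) :
    levelDim f t = Module.finrank (ZMod 2) (Submodule.span (ZMod 2)
      {s | 1 / t ≤ |hat (fun v => f ((cubeEquiv n).symm v)) s|}) := by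
  have h : indicatorVec '' {S : Finset (Fin n) | 1 / t ≤ |fourierCoeff f S|}
      = {s | 1 / t ≤ |hat (fun v => f ((cubeEquiv n).symm v)) s|} := by
    simp only [fourierCoeff_eq_hat]
    exact Set.image_preimage_eq {s | 1 / t ≤ |hat _ s|} indicatorVec_surjective
  rw [levelDim, h]

lemma weight_eq {n : ℕ} (f : (Fin n → Bool) → ℝ) :
    weight f = ((Finset.univ.filter
      (fun v => f ((cubeEquiv n).symm v) = -1)).card : ℝ) / 2 ^ n := by
  rw [weight]
  congr 2
  exact Finset.card_equiv (cubeEquiv n) fun x => by simp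

lemma hat_zero_eq {n : ℕ} {F : (Fin n → ZMod 2) → ℝ} (hF : ∀ x, F x = 1 ∨ F x = -1) :
    hat F 0 = 1 - 2 * (((Finset.univ.filter (fun x => F x = -1)).card : ℝ) / 2 ^ n) := by
  rw [hat_eq_of_sign hF]
  simp [sg_zero, mul_div_assoc]

lemma harmonic_le_two_mul_logb {k : ℕ} (hk : 1 < k) :
    (harmonic k : ℝ) ≤ 2 * Real.logb 2 k := by
  have hk' : (2 : ℝ) ≤ k := by exact_mod_cast hk
  have h1 := harmonic_le_one_add_log k
  have h2 : 1 ≤ Real.logb 2 k := by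
    rw [Real.le_logb_iff_rpow_le (by norm_num) (by linarith)]; simpa using hk'
  have h3 : Real.log k ≤ Real.logb 2 k := by
    rw [Real.logb, le_div_iff₀ (Real.log_pos (by norm_num))]
    have h4 : Real.log 2 ≤ 1 := by linarith [Real.log_two_lt_d9]
    nlinarith [Real.log_nonneg (by linarith : (1 : ℝ) ≤ k)]
  linarith

lemma sq_fourierRank_div_le {n : ℕ} {f : (Fin n → Bool) → ℝ} (hf : IsBooleanFunc f)
    (hk : 1 < sparsity f) :
    1 / (sparsity f : ℝ) * ((fourierRank f : ℝ) / Real.logb 2 (sparsity f)) ^ 2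
      ≤ 288 * weight f := by
  have hF : ∀ v, (fun v => f ((cubeEquiv n).symm v)) v = 1
      ∨ (fun v => f ((cubeEquiv n).symm v)) v = -1 := fun v => hf _
  have hw : 0 ≤ weight f := by unfold weight; positivity
  have h0 := hat_zero_eq hF
  rw [← weight_eq] at h0
  have h := finrank_span_hatSupport_le hF (by rw [h0]; linarith)
  rw [← fourierRank_eq, ← sparsity_eq, h0, sub_sub_cancel] at h
  have hk' : (0 : ℝ) < sparsity f := by exact_mod_cast (zero_lt_one.trans hk)
  have hlog : 0 < Real.logb 2 (sparsity f) := Real.logb_pos (by norm_num) (by exact_mod_cast hk)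
  have h1 : (fourierRank f : ℝ) / Real.logb 2 (sparsity f)
      ≤ 12 * √(2 * weight f * sparsity f) := by
    rw [div_le_iff₀ hlog]
    refine h.trans ((mul_le_mul_of_nonneg_left (harmonic_le_two_mul_logb hk)
      (by positivity)).trans (le_of_eq (by ring)))
  have h2 := pow_le_pow_left₀ (by positivity) h1 2
  rw [mul_pow, Real.sq_sqrt (by positivity)] at h2
  rw [one_div, inv_mul_le_iff₀ hk']
  linarith

lemma fourierRank_pos {n : ℕ} {f : (Fin n → Bool) → ℝ} (hk : 1 < sparsity f) :
    0 < fourierRank f := by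
  rw [sparsity_eq] at hk
  rw [fourierRank_eq]
  obtain ⟨s, hs, hne⟩ := Finset.exists_mem_ne hk 0
  refine Module.finrank_pos_iff_exists_ne_zero.2 ⟨⟨s, Submodule.subset_span hs⟩, ?_⟩
  simpa using hne

lemma fourierRank_div_maxRankEntropy_le {n : ℕ} {f : (Fin n → Bool) → ℝ} (hf : IsBooleanFunc f)
    (hk : 1 < sparsity f) :
    (fourierRank f : ℝ) / (maxRankEntropy f * Real.logb 2 (sparsity f)) ≤ 2 * weight f := by
  have hF : ∀ v, (fun v => f ((cubeEquiv n).symm v)) v = 1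
      ∨ (fun v => f ((cubeEquiv n).symm v)) v = -1 := fun v => hf _
  have hw : 0 ≤ weight f := by unfold weight; positivity
  have hlog : 0 < Real.logb 2 (sparsity f) := Real.logb_pos (by norm_num) (by exact_mod_cast hk)
  have key : ∀ t, 0 < t → levelDim f t = fourierRank f →
      (fourierRank f : ℝ) ≤ t * (2 * Real.logb 2 (sparsity f) * weight f) := by
    intro t ht h
    have h1 := finrank_span_mul_le hF (by rwa [← sparsity_eq])
      (by rw [← sparsity_eq]; exact Nat.lt_pow_succ_log_self (by norm_num) _)
      (T := {s | 1 / t ≤ |hat (fun v => f ((cubeEquiv n).symm v)) s|}) (fun s hs => hs)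
    rw [← levelDim_eq, h, ← weight_eq, mul_one_div, div_le_iff₀ ht] at h1
    have h2 : (Nat.log 2 (sparsity f) : ℝ) ≤ Real.logb 2 (sparsity f) := by
      exact_mod_cast Real.natLog_le_logb (sparsity f) 2
    refine h1.trans ?_
    rw [mul_comm]
    gcongr
  have hr : (0 : ℝ) < fourierRank f := by exact_mod_cast fourierRank_pos hk
  rcases Set.eq_empty_or_nonempty {t : ℝ | 0 < t ∧ levelDim f t = fourierRank f} with he | hne
  · rw [maxRankEntropy, he, Real.sInf_empty, zero_mul, div_zero]; positivity
  obtain ⟨t₀, ht₀, h₀⟩ := hne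
  have hpos : 0 < 2 * Real.logb 2 (sparsity f) * weight f :=
    pos_of_mul_pos_right (hr.trans_le (key t₀ ht₀ h₀)) ht₀.le
  have h1 : (fourierRank f : ℝ) / (2 * Real.logb 2 (sparsity f) * weight f)
      ≤ maxRankEntropy f :=
    le_csInf ⟨t₀, ht₀, h₀⟩ fun t ht => (div_le_iff₀ hpos).2 (key t ht.1 ht.2)
  have h2 : 0 < maxRankEntropy f := (div_pos hr hpos).trans_le h1
  rw [div_le_iff₀ (by positivity)]
  rw [div_le_iff₀ hpos] at h1
  linarith

/-- **Theorem.** There is a universal constant `c > 0` such that every Boolean function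
`f` with `k(f) > 1` satisfies
`δ(f) ≥ c · max{ (1/k(f)) · (r(f)/log₂ k(f))² , r(f)/(k''(f) · log₂ k(f)) }`. -/
theorem delta_lower_bound_rank_sparsity_maxRankEntropy :
    ∃ c : ℝ, 0 < c ∧
      ∀ (n : ℕ), 0 < n → ∀ f : (Fin n → Bool) → ℝ, IsBooleanFunc f →
        1 < sparsity f →
        c * max ((1 / (sparsity f : ℝ)) *
              ((fourierRank f : ℝ) / Real.logb 2 (sparsity f)) ^ 2)
            ((fourierRank f : ℝ) / (maxRankEntropy f * Real.logb 2 (sparsity f)))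
          ≤ weight f := by
  refine ⟨1 / 288, by norm_num, fun n _ f hf hk => ?_⟩
  have hw : 0 ≤ weight f := by unfold weight; positivity
  have h := max_le (sq_fourierRank_div_le hf hk)
    ((fourierRank_div_maxRankEntropy_le hf hk).trans
      (by linarith : 2 * weight f ≤ 288 * weight f))
  linarith

end BoolFunc

end
end
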